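/- arXiv:1802.04179 — 9 statements merged into one kernel-verified Lean document; each statement's English description precedes it below -/
import Mathlib

section
/- Let P = v_1 v_2 v_3 v_4 be a path on four vertices and let L be a list assignment for P such that |L(v_1)| = |L(v_3)| = |L(v_4)| = 5, |L(v_2)| = 8, and the subpath v_3 v_4 of P has an (L:3)-coloring. Then P is (L:3)-colorable; moreover, for any colors α ∈ L(v_1) and β ∈ L(v_4), the path P has an (L:3)-coloring φ such that α ∈ φ(v_1) and β ∈ φ(v_4). -/
/-- `φ` is an `(L:3)`-coloring of `G`. -/
def IsL3Coloring {V : Type*} (G : SimpleGraph V) (L : V → Finset ℕ)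
    (φ : V → Finset ℕ) : Prop :=
  (∀ v, φ v ⊆ L v) ∧ (∀ v, (φ v).card = 3) ∧ ∀ ⦃u v⦄, G.Adj u v → Disjoint (φ u) (φ v)

/-- The subgraph of `G` induced on the vertex set `s` has an `(L:3)`-coloring. -/
def HasL3ColoringOn {V : Type*} (G : SimpleGraph V) (L : V → Finset ℕ) (s : Set V) : Prop :=
  ∃ φ : V → Finset ℕ, (∀ v ∈ s, φ v ⊆ L v) ∧ (∀ v ∈ s, (φ v).card = 3) ∧
    ∀ u ∈ s, ∀ v ∈ s, G.Adj u v → Disjoint (φ u) (φ v)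

theorem Finset.exists_subset_card_eq_of_mem {ι : Type*} {s : Finset ι} {x : ι} {n : ℕ}
    (hx : x ∈ s) (hn : 1 ≤ n) (hs : n ≤ s.card) : ∃ t ⊆ s, t.card = n ∧ x ∈ t := by
  obtain ⟨t, hxt, hts, ht⟩ := Finset.exists_subsuperset_card_eq
    (Finset.singleton_subset_iff.2 hx) (by simpa using hn) hs
  exact ⟨t, hts, ht, Finset.singleton_subset_iff.1 hxt⟩

/-- Removing a triple `c ≠ B \ A` from a list `B` of size 8 lets us colour the first edge of a path
with any prescribed colour at the end vertex, whose list is `A`. -/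
theorem exists_disjoint_triples {A B c : Finset ℕ} {α : ℕ} (hA : A.card = 5) (hB : B.card = 8)
    (hc : c.card = 3) (hα : α ∈ A) (hne : c ≠ B \ A) :
    ∃ a ⊆ A, ∃ b ⊆ B, a.card = 3 ∧ b.card = 3 ∧ Disjoint a b ∧ Disjoint b c ∧ α ∈ a := by
  have hBc : B.card - c.card ≤ (B \ c).card := Finset.le_card_sdiff c B
  have hT : (B \ c).card - 1 ≤ ((B \ c).erase α).card := Finset.pred_card_le_card_erase
  have hAα : (A.erase α).card = 4 := by rw [Finset.card_erase_of_mem hα, hA]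
  obtain ⟨t, htT, htA⟩ : ∃ t ∈ (B \ c).erase α, t ∉ A := by
    by_contra! h
    have hsub : (B \ c).erase α ⊆ A.erase α := fun x hx =>
      Finset.mem_erase.2 ⟨(Finset.mem_erase.1 hx).1, h x hx⟩
    have heq : (B \ c).erase α = A.erase α := Finset.eq_of_subset_of_card_le hsub (by omega)
    have hαB : α ∈ B \ c := by
      by_contra hα'
      rw [Finset.erase_eq_of_notMem hα'] at heq
      rw [heq] at hBc
      omega
    have hBA : B \ c = A := by
      rw [← Finset.insert_erase hαB, heq, Finset.insert_erase hα]
    have hle : B \ A ⊆ c := fun x hx => by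
      rw [← hBA] at hx
      grind
    have hcard : B.card - A.card ≤ (B \ A).card := Finset.le_card_sdiff A B
    exact hne (Finset.eq_of_subset_of_card_le hle (by omega)).symm
  obtain ⟨b, hbT, hb, htb⟩ := Finset.exists_subset_card_eq_of_mem (n := 3) htT (by omega) (by omega)
  have hAb : A \ b.erase t = A \ b := by grind
  have hAb' : A.card - (b.erase t).card ≤ (A \ b.erase t).card := Finset.le_card_sdiff _ _
  rw [hAb, Finset.card_erase_of_mem htb] at hAb'
  have hαb : α ∈ A \ b := Finset.mem_sdiff.2 ⟨hα, fun h => by simpa using hbT h⟩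
  obtain ⟨a, haA, ha, hαa⟩ := Finset.exists_subset_card_eq_of_mem (n := 3) hαb (by omega) (by omega)
  refine ⟨a, haA.trans Finset.sdiff_subset, b,
    (hbT.trans (Finset.erase_subset _ _)).trans Finset.sdiff_subset, ha, hb, ?_, ?_, hαa⟩
  · exact Finset.sdiff_disjoint.mono_left haA
  · exact Finset.sdiff_disjoint.mono_left (hbT.trans (Finset.erase_subset _ _))

/-- A triple `c ≠ E` can be chosen on one end of an edge so that the other end is colourable with
a prescribed colour `β`. -/
theorem exists_disjoint_triples_ne {C D : Finset ℕ} (E : Finset ℕ) {β γ : ℕ} (hC : C.card = 5)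
    (hD : D.card = 5) (hβ : β ∈ D) (hγC : γ ∈ C) (hγD : γ ∉ D) :
    ∃ c ⊆ C, ∃ d ⊆ D, c.card = 3 ∧ d.card = 3 ∧ Disjoint c d ∧ β ∈ d ∧ c ≠ E := by
  have hS : 2 < ((C.erase γ).erase β).card := by
    have h₁ := Finset.card_erase_of_mem hγC
    have h₂ : (C.erase γ).card - 1 ≤ ((C.erase γ).erase β).card :=
      Finset.pred_card_le_card_erase
    omega
  obtain ⟨x, hx, y, hy, z, hz, hxy, hxz, hyz⟩ := Finset.two_lt_card.1 hS
  simp only [Finset.mem_erase] at hx hy hz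
  obtain ⟨w, hw, hxw, hne⟩ : ∃ w, (w ≠ β ∧ w ≠ γ ∧ w ∈ C) ∧ x ≠ w ∧ {γ, x, w} ≠ E := by
    by_cases h : {γ, x, y} = E
    · refine ⟨z, hz, hxz, fun h' => ?_⟩
      have hy' : y ∈ ({γ, x, z} : Finset ℕ) := by rw [h', ← h]; simp
      grind
    · exact ⟨y, hy, hxy, h⟩
  have hDc : D \ {x, w} = D \ {γ, x, w} := by grind
  have hcard : D.card - ({x, w} : Finset ℕ).card ≤ (D \ {x, w}).card := Finset.le_card_sdiff _ _
  rw [hDc, Finset.card_pair hxw] at hcard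
  have hβ' : β ∈ D \ {γ, x, w} := by grind
  obtain ⟨d, hdD, hd, hβd⟩ := Finset.exists_subset_card_eq_of_mem (n := 3) hβ' (by omega) (by omega)
  refine ⟨{γ, x, w}, by grind, d, hdD.trans Finset.sdiff_subset, ?_, hd, ?_, hβd, hne⟩
  · exact Finset.card_eq_three.2 ⟨γ, x, w, hx.2.1.symm, hw.2.1.symm, hxw, rfl⟩
  · exact Finset.disjoint_sdiff.mono_right hdD

theorem stmt_3 (L : Fin 4 → Finset ℕ)
    (h1 : (L 0).card = 5) (h2 : (L 1).card = 8) (h3 : (L 2).card = 5) (h4 : (L 3).card = 5)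
    (hsub : HasL3ColoringOn (SimpleGraph.pathGraph 4) L {2, 3}) :
    (∃ φ, IsL3Coloring (SimpleGraph.pathGraph 4) L φ) ∧
    ∀ α ∈ L 0, ∀ β ∈ L 3,
      ∃ φ, IsL3Coloring (SimpleGraph.pathGraph 4) L φ ∧ α ∈ φ 0 ∧ β ∈ φ 3 := by
  obtain ⟨γ, hγC, hγD⟩ : ∃ γ ∈ L 2, γ ∉ L 3 := by
    by_contra! hCD
    obtain ⟨ψ, hψL, hψ, hdisj⟩ := hsub
    have hd := hdisj 2 (by simp) 3 (by simp) (by simp [SimpleGraph.pathGraph_adj])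
    have hle := Finset.card_le_card
      (Finset.union_subset ((hψL 2 (by simp)).trans hCD) (hψL 3 (by simp)))
    rw [Finset.card_union_of_disjoint hd, hψ 2 (by simp), hψ 3 (by simp), h4] at hle
    omega
  have main : ∀ α ∈ L 0, ∀ β ∈ L 3,
      ∃ φ, IsL3Coloring (SimpleGraph.pathGraph 4) L φ ∧ α ∈ φ 0 ∧ β ∈ φ 3 := by
    intro α hα β hβ
    obtain ⟨c, hcC, d, hdD, hc, hd, hcd, hβd, hne⟩ :=
      exists_disjoint_triples_ne (L 1 \ L 0) h3 h4 hβ hγC hγD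
    obtain ⟨a, haA, b, hbB, ha, hb, hab, hbc, hαa⟩ := exists_disjoint_triples h1 h2 hc hα hne
    refine ⟨![a, b, c, d], ⟨?_, ?_, ?_⟩, hαa, hβd⟩
    · intro v; fin_cases v <;> assumption
    · intro v; fin_cases v <;> assumption
    · intro u v huv
      rw [SimpleGraph.pathGraph_adj] at huv
      fin_cases u <;> fin_cases v <;> simp at huv <;>
        first | assumption | exact Disjoint.symm (by assumption)
  refine ⟨?_, main⟩
  obtain ⟨α, hα⟩ := Finset.card_pos.1 (by omega : 0 < (L 0).card)
  obtain ⟨β, hβ⟩ := Finset.card_pos.1 (by omega : 0 < (L 3).card)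
  obtain ⟨φ, hφ, -⟩ := main α hα β hβ
  exact ⟨φ, hφ⟩
end

section
/- Let P = v_1 v_2 v_3 v_4 v_5 be a path on five vertices and let L be a list assignment for P such that |L(v_1)| = |L(v_3)| = |L(v_4)| = |L(v_5)| = 5, |L(v_2)| = 8, and the subpath v_3 v_4 v_5 has an (L:3)-coloring. Then P is (L:3)-colorable; moreover, for any colors α ∈ L(v_1) and β ∈ L(v_5) such that {β} ≠ L(v_4) \ L(v_3), the path P has an (L:3)-coloring φ such that α ∈ φ(v_1) and β ∈ φ(v_5). -/
open Finset in
/-- If a set `Y` of three colors is not contained in the list `E` of five colors, three colors of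
`E` outside `Y` can be chosen so as to include a prescribed one. -/
theorem exists_mem_subset_disjoint_card_three {E Y : Finset ℕ} {β e : ℕ} (hE : #E = 5)
    (hY : #Y = 3) (heY : e ∈ Y) (heE : e ∉ E) (hβ : β ∈ E) (hβY : β ∉ Y) :
    ∃ Z ⊆ E, #Z = 3 ∧ Disjoint Y Z ∧ β ∈ Z := by
  have hcard : 3 ≤ #(E \ Y) := by
    have h := le_card_sdiff (Y.erase e) E
    have hEY : E \ Y.erase e = E \ Y := by
      grind
    rw [hEY, card_erase_of_mem heY] at h
    omega
  have hsub : {β} ⊆ E \ Y := by simp [hβ, hβY]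
  obtain ⟨Z, hβZ, hZ, hZ3⟩ := exists_subsuperset_card_eq hsub (by simp) hcard
  exact ⟨Z, fun x hx => (mem_sdiff.1 (hZ hx)).1, hZ3,
    disjoint_right.2 fun x hx => (mem_sdiff.1 (hZ hx)).2, by simpa using hβZ⟩

open Finset in
/-- A set of at least four elements has a three-element subset which differs from a given set `S`
and omits one of two given elements. -/
theorem exists_card_three_ne_notMem {T : Finset ℕ} (hT : 4 ≤ #T) (S : Finset ℕ) {f g : ℕ}
    (hfg : f ≠ g) : ∃ X ⊆ T, #X = 3 ∧ X ≠ S ∧ (f ∉ X ∨ g ∉ X) := by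
  have hcard (x : ℕ) : 3 ≤ #(T.erase x) := by
    have := pred_card_le_card_erase (s := T) (a := x)
    omega
  obtain ⟨X, hX, hX3⟩ := exists_subset_card_eq (hcard f)
  obtain ⟨X', hX', hX'3⟩ := exists_subset_card_eq (hcard g)
  by_cases h : X = S
  · by_cases h' : X' = S
    · subst h h'
      obtain ⟨s, hs⟩ : X'.Nonempty := card_pos.1 (by omega)
      obtain ⟨t, ht, htX⟩ := exists_mem_notMem_of_card_lt_card (s := X') (t := T) (by omega)
      refine ⟨insert t (X'.erase s), ?_, ?_, ?_, ?_⟩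
      · grind
      · rw [card_insert_of_notMem (by grind), card_erase_of_mem hs]
        omega
      · grind
      · grind
    · exact ⟨X', by grind, hX'3, h', by grind⟩
  · exact ⟨X, by grind, hX3, h, by grind⟩

open Finset in
/-- Three consecutive vertices with lists `C`, `D`, `E` can be colored so that the last vertex
receives `β` while the color set of the first vertex is not `S`. -/
theorem exists_path_three_coloring {C D E : Finset ℕ} {β d e : ℕ} (hC : #C = 5) (hD : #D = 5)
    (hE : #E = 5) (hd : d ∈ D) (hdC : d ∉ C) (hdβ : d ≠ β) (he : e ∈ D) (heE : e ∉ E)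
    (hβ : β ∈ E) (S : Finset ℕ) :
    ∃ X Y Z : Finset ℕ, X ⊆ C ∧ Y ⊆ D ∧ Z ⊆ E ∧ #X = 3 ∧ #Y = 3 ∧ #Z = 3 ∧
      Disjoint X Y ∧ Disjoint Y Z ∧ β ∈ Z ∧ X ≠ S := by
  have hDβ := pred_card_le_card_erase (s := D) (a := β)
  have hde : {d, e} ⊆ D.erase β := by grind
  obtain ⟨W, hdeW, hW, hW2⟩ :=
    exists_subsuperset_card_eq hde card_le_two (show 2 ≤ #(D.erase β) by omega)
  have hCW : 4 ≤ #(C \ W) := by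
    have h := le_card_sdiff (W.erase d) C
    have hEq : C \ W.erase d = C \ W := by grind
    rw [hEq, card_erase_of_mem (by grind)] at h
    omega
  have hDW : 1 < #(D.erase β \ W) := by
    have := le_card_sdiff W (D.erase β)
    omega
  obtain ⟨f, hf, g, hg, hfg⟩ := one_lt_card.1 hDW
  obtain ⟨X, hX, hX3, hXS, hfgX⟩ := exists_card_three_ne_notMem hCW S hfg
  obtain ⟨k, hk, hkX⟩ : ∃ k ∈ D.erase β \ W, k ∉ X := by
    rcases hfgX with h | h
    exacts [⟨f, hf, h⟩, ⟨g, hg, h⟩]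
  have hY3 : #(insert k W) = 3 := by
    rw [card_insert_of_notMem (by grind), hW2]
  obtain ⟨Z, hZ, hZ3, hYZ, hβZ⟩ :=
    exists_mem_subset_disjoint_card_three hE hY3 (by grind) heE hβ (by grind)
  exact ⟨X, insert k W, Z, by grind, by grind, hZ, hX3, hY3, hZ3,
    disjoint_left.2 (by grind), hYZ, hβZ, hXS⟩

open Finset in
/-- If a vertex with list `B` has neighbors with lists `A` and color set `X ≠ B \ A`, then the
coloring extends to these two vertices, with a prescribed color used on the far one. -/
theorem exists_extension_of_ne_sdiff {A B X : Finset ℕ} {α : ℕ} (hA : #A = 5) (hB : #B = 8)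
    (hX : #X = 3) (hα : α ∈ A) (hXB : X ≠ B \ A) :
    ∃ U V : Finset ℕ, U ⊆ A ∧ V ⊆ B ∧ #U = 3 ∧ #V = 3 ∧ α ∈ U ∧ Disjoint U V ∧
      Disjoint V X := by
  have hBX := le_card_sdiff X B
  suffices h : ∃ U ⊆ A, #U = 3 ∧ α ∈ U ∧ 3 ≤ #((B \ X) \ U) by
    obtain ⟨U, hU, hU3, hαU, h3⟩ := h
    obtain ⟨V, hV, hV3⟩ := exists_subset_card_eq h3
    exact ⟨U, V, hU, by grind, hU3, hV3, hαU, disjoint_left.2 (by grind),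
      disjoint_left.2 (by grind)⟩
  by_cases hsub : A ⊆ B \ X
  · have hlt : 6 ≤ #(B \ X) := by
      by_contra hlt
      have hEq : A = B \ X := eq_of_subset_of_card_le hsub (by omega)
      have hXB' : B \ A ⊆ X := by grind
      have := le_card_sdiff A B
      exact hXB (eq_of_subset_of_card_le hXB' (by omega)).symm
    obtain ⟨U, hαU, hU, hU3⟩ := exists_subsuperset_card_eq
      (singleton_subset_iff.2 hα) (by simp) (show 3 ≤ #A by omega)
    have := le_card_sdiff U (B \ X)
    exact ⟨U, hU, hU3, by simpa using hαU, by omega⟩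
  · obtain ⟨c, hc, hcBX⟩ := not_subset.1 hsub
    have hαc : {α, c} ⊆ A := by grind
    obtain ⟨U, hαcU, hU, hU3⟩ := exists_subsuperset_card_eq
      hαc (card_le_two.trans (by norm_num)) (show 3 ≤ #A by omega)
    refine ⟨U, hU, hU3, by grind, ?_⟩
    have h := le_card_sdiff (U.erase c) (B \ X)
    have hEq : (B \ X) \ U.erase c = (B \ X) \ U := by grind
    rw [hEq, card_erase_of_mem (by grind)] at h
    omega

theorem stmt_4 (L : Fin 5 → Finset ℕ)
    (h1 : (L 0).card = 5) (h2 : (L 1).card = 8) (h3 : (L 2).card = 5) (h4 : (L 3).card = 5)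
    (h5 : (L 4).card = 5)
    (hsub : HasL3ColoringOn (SimpleGraph.pathGraph 5) L {2, 3, 4}) :
    (∃ φ, IsL3Coloring (SimpleGraph.pathGraph 5) L φ) ∧
    ∀ α ∈ L 0, ∀ β ∈ L 4, ({β} : Finset ℕ) ≠ L 3 \ L 2 →
      ∃ φ, IsL3Coloring (SimpleGraph.pathGraph 5) L φ ∧ α ∈ φ 0 ∧ β ∈ φ 4 := by
  obtain ⟨ψ, hψL, hψ3, hψ⟩ := hsub
  have not_subset_of_adj {i : Fin 5} (hi : i ∈ ({2, 3, 4} : Set (Fin 5)))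
      (hadj : (SimpleGraph.pathGraph 5).Adj i 3) (hLi : (L i).card = 5) : ¬ L 3 ⊆ L i := by
    intro h
    have hmem : (3 : Fin 5) ∈ ({2, 3, 4} : Set (Fin 5)) := by simp
    have hle := Finset.card_le_card (Finset.union_subset (hψL i hi) ((hψL 3 hmem).trans h))
    rw [Finset.card_union_of_disjoint (hψ i hi 3 hmem hadj), hψ3 i hi, hψ3 3 hmem, hLi] at hle
    omega
  have hDC : (L 3 \ L 2).Nonempty := Finset.sdiff_nonempty.2
    (not_subset_of_adj (by simp) (by simp [SimpleGraph.pathGraph_adj]) h3)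
  obtain ⟨e, he, heE⟩ := Finset.not_subset.1
    (not_subset_of_adj (i := 4) (by simp) (by simp [SimpleGraph.pathGraph_adj]) h5)
  have main : ∀ α ∈ L 0, ∀ β ∈ L 4, ({β} : Finset ℕ) ≠ L 3 \ L 2 →
      ∃ φ, IsL3Coloring (SimpleGraph.pathGraph 5) L φ ∧ α ∈ φ 0 ∧ β ∈ φ 4 := by
    intro α hα β hβ hne
    obtain ⟨d, hd, hdβ⟩ : ∃ d ∈ L 3 \ L 2, d ≠ β := by
      by_contra! h
      exact hne (Finset.eq_singleton_iff_nonempty_unique_mem.2 ⟨hDC, h⟩).symm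
    rw [Finset.mem_sdiff] at hd
    obtain ⟨X, Y, Z, hX, hY, hZ, hX3, hY3, hZ3, hXY, hYZ, hβZ, hXS⟩ :=
      exists_path_three_coloring h3 h4 h5 hd.1 hd.2 hdβ he heE hβ (L 1 \ L 0)
    obtain ⟨U, V, hU, hV, hU3, hV3, hαU, hUV, hVX⟩ :=
      exists_extension_of_ne_sdiff h1 h2 hX3 hα hXS
    refine ⟨![U, V, X, Y, Z], ⟨?_, ?_, ?_⟩, hαU, hβZ⟩
    · intro v
      fin_cases v <;> assumption
    · intro v
      fin_cases v <;> assumption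
    · intro u v huv
      rw [SimpleGraph.pathGraph_adj] at huv
      fin_cases u <;> fin_cases v <;>
        first
        | (exfalso; revert huv; decide)
        | assumption
        | (apply Disjoint.symm; assumption)
  refine ⟨?_, main⟩
  obtain ⟨α, hα⟩ : (L 0).Nonempty := Finset.card_pos.1 (by omega)
  obtain ⟨β, hβ, γ, hγ, hβγ⟩ := Finset.one_lt_card.1 (show 1 < (L 4).card by omega)
  by_cases h : ({β} : Finset ℕ) = L 3 \ L 2
  · have hγ' : ({γ} : Finset ℕ) ≠ L 3 \ L 2 := fun h' =>
      hβγ (Finset.singleton_injective (h.trans h'.symm))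
    obtain ⟨φ, hφ, -⟩ := main α hα γ hγ hγ'
    exact ⟨φ, hφ⟩
  · obtain ⟨φ, hφ, -⟩ := main α hα β hβ h
    exact ⟨φ, hφ⟩
end

section
/- Let P = v_1 v_2 v_3 v_4 v_5 v_6 be a path on six vertices and let L be a list assignment for P such that |L(v_1)| = |L(v_3)| = |L(v_4)| = |L(v_5)| = |L(v_6)| = 5, |L(v_2)| = 8, and the subpath v_3 v_4 v_5 v_6 has an (L:3)-coloring. Then P is (L:3)-colorable; moreover, for any color α ∈ L(v_1), the path P has an (L:3)-coloring φ such that α ∈ φ(v_1). -/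
/-- If at least three colors of `L` avoid `B`, any of them lies in an admissible color set. -/
theorem exists_triple_mem_disjoint {L B : Finset ℕ} {x : ℕ} (hx : x ∈ L) (hxB : x ∉ B)
    (hc : 3 ≤ (L \ B).card) :
    ∃ A ⊆ L, A.card = 3 ∧ Disjoint A B ∧ x ∈ A := by
  obtain ⟨A, hxA, hAL, hA⟩ := Finset.exists_subsuperset_card_eq
    (s := {x}) (t := L \ B) (n := 3) (by simp [hx, hxB]) (by simp) hc
  exact ⟨A, hAL.trans Finset.sdiff_subset, hA,
    Finset.disjoint_of_subset_left hAL Finset.sdiff_disjoint,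
    hxA (Finset.mem_singleton_self x)⟩

theorem card_insert_erase {A : Finset ℕ} {x y : ℕ} (hx : x ∈ A) (hy : y ∉ A) :
    (insert y (A.erase x)).card = A.card := by
  rw [Finset.card_insert_of_notMem (fun h => hy (Finset.mem_of_mem_erase h)),
    Finset.card_erase_add_one hx]

theorem insert_erase_subset {A L : Finset ℕ} {x y : ℕ} (hA : A ⊆ L) (hy : y ∈ L) :
    insert y (A.erase x) ⊆ L :=
  Finset.insert_subset hy ((Finset.erase_subset x A).trans hA)

/-- The sets `A₁`, …, `A₄` form an `(L:3)`-coloring of a path on four vertices with lists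
`L₁`, …, `L₄`. -/
def IsPathColoring (L₁ L₂ L₃ L₄ A₁ A₂ A₃ A₄ : Finset ℕ) : Prop :=
  (A₁ ⊆ L₁ ∧ A₂ ⊆ L₂ ∧ A₃ ⊆ L₃ ∧ A₄ ⊆ L₄) ∧
  (A₁.card = 3 ∧ A₂.card = 3 ∧ A₃.card = 3 ∧ A₄.card = 3) ∧
  Disjoint A₁ A₂ ∧ Disjoint A₂ A₃ ∧ Disjoint A₃ A₄

section

variable {L₁ L₂ L₃ L₄ A₁ A₂ A₃ A₄ : Finset ℕ}

/-- The second vertex gives up `x` for `p`, which lets the first vertex use `x`. -/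
theorem IsPathColoring.exists_recolor_of_exchange (h : IsPathColoring L₁ L₂ L₃ L₄ A₁ A₂ A₃ A₄)
    {B₃ B₄ : Finset ℕ} {x p : ℕ}
    (hx : x ∈ L₁) (hxA₁ : x ∉ A₁) (hxA₂ : x ∈ A₂) (hp : p ∈ L₂) (hpA₂ : p ∉ A₂)
    (hB₃ : B₃ ⊆ L₃) (hB₄ : B₄ ⊆ L₄) (hB₃c : B₃.card = 3) (hB₄c : B₄.card = 3)
    (hd : Disjoint (insert p (A₂.erase x)) B₃) (hd' : Disjoint B₃ B₄) :
    ∃ B₁ B₂ B₃ B₄, IsPathColoring L₁ L₂ L₃ L₄ B₁ B₂ B₃ B₄ ∧ ¬ B₁ ⊆ A₁ := by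
  obtain ⟨⟨hA₁, hA₂, -, -⟩, ⟨hc₁, hc₂, -, -⟩, hd₁₂, -, -⟩ := h
  have hxp : x ≠ p := fun e => hpA₂ (e ▸ hxA₂)
  have hsub : (insert x A₁).erase p ⊆ L₁ \ insert p (A₂.erase x) := by
    intro c hc
    have : c ∈ A₁ → c ∉ A₂ := fun h => Finset.disjoint_left.mp hd₁₂ h
    have := @hA₁ c
    grind
  have hcard : 3 ≤ (L₁ \ insert p (A₂.erase x)).card := by
    have h1 := Finset.card_le_card hsub
    have h2 := Finset.pred_card_le_card_erase (a := p) (s := insert x A₁)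
    rw [Finset.card_insert_of_notMem hxA₁] at h2
    omega
  obtain ⟨B₁, hB₁, hB₁c, hB₁d, hxB₁⟩ := exists_triple_mem_disjoint hx (by simp [hxp]) hcard
  exact ⟨B₁, insert p (A₂.erase x), B₃, B₄,
    ⟨⟨hB₁, insert_erase_subset hA₂ hp, hB₃, hB₄⟩,
      ⟨hB₁c, (card_insert_erase hxA₂ hpA₂).trans hc₂, hB₃c, hB₄c⟩, hB₁d, hd, hd'⟩,
    fun hs => hxA₁ (hs hxB₁)⟩

theorem exists_mem_sdiff_ne (hL : A₁.card + 2 ≤ L₁.card) (a : ℕ) :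
    ∃ b ∈ L₁, b ∉ A₁ ∧ b ≠ a := by
  obtain ⟨b, hb, hb'⟩ := Finset.exists_mem_notMem_of_card_lt_card
    (s := insert a A₁) (t := L₁) (by have := Finset.card_insert_le a A₁; omega)
  rw [Finset.mem_insert, not_or] at hb'
  exact ⟨b, hb, hb'.2, hb'.1⟩

/-- The color set of the first vertex of a path with lists of size five is never forced. -/
theorem IsPathColoring.exists_recolor (h : IsPathColoring L₁ L₂ L₃ L₄ A₁ A₂ A₃ A₄)
    (hL₁ : L₁.card = 5) (hL₂ : L₂.card = 5) (hL₃ : L₃.card = 5) (hL₄ : L₄.card = 5) :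
    ∃ B₁ B₂ B₃ B₄, IsPathColoring L₁ L₂ L₃ L₄ B₁ B₂ B₃ B₄ ∧ ¬ B₁ ⊆ A₁ := by
  have h' := h
  obtain ⟨⟨hA₁, hA₂, hA₃, hA₄⟩, ⟨hc₁, hc₂, hc₃, hc₄⟩, hd₁₂, hd₂₃, hd₃₄⟩ := h'
  rw [Finset.disjoint_left] at hd₂₃ hd₃₄
  by_cases hfree : ∃ x ∈ L₁, x ∉ A₁ ∧ x ∉ A₂
  · obtain ⟨x, hx, hxA₁, hxA₂⟩ := hfree
    have hcard : 3 ≤ (L₁ \ A₂).card :=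
      hc₁ ▸ Finset.card_le_card (Finset.subset_sdiff.mpr ⟨hA₁, hd₁₂⟩)
    obtain ⟨B₁, hB₁, hB₁c, hB₁d, hxB₁⟩ := exists_triple_mem_disjoint hx hxA₂ hcard
    exact ⟨B₁, A₂, A₃, A₄, ⟨⟨hB₁, hA₂, hA₃, hA₄⟩, ⟨hB₁c, hc₂, hc₃, hc₄⟩, hB₁d,
      h.2.2.2.1, h.2.2.2.2⟩, fun hs => hxA₁ (hs hxB₁)⟩
  push Not at hfree
  obtain ⟨x, hx, hxA₁, -⟩ := exists_mem_sdiff_ne (A₁ := A₁) (L₁ := L₁) (by omega) 0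
  obtain ⟨y, hy, hyA₁, hyx⟩ := exists_mem_sdiff_ne (A₁ := A₁) (L₁ := L₁) (by omega) x
  have hxA₂ := hfree x hx hxA₁
  have hyA₂ := hfree y hy hyA₁
  by_cases hfree₂ : ∃ p ∈ L₂, p ∉ A₂ ∧ p ∉ A₃
  · obtain ⟨p, hp, hpA₂, hpA₃⟩ := hfree₂
    refine h.exists_recolor_of_exchange hx hxA₁ hxA₂ hp hpA₂ hA₃ hA₄ hc₃ hc₄ ?_ h.2.2.2.2
    rw [Finset.disjoint_left]
    grind
  push Not at hfree₂
  obtain ⟨p, hp, hpA₂, -⟩ := exists_mem_sdiff_ne (A₁ := A₂) (L₁ := L₂) (by omega) 0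
  obtain ⟨q, hq, hqA₂, hqp⟩ := exists_mem_sdiff_ne (A₁ := A₂) (L₁ := L₂) (by omega) p
  have hpA₃ := hfree₂ p hp hpA₂
  have hqA₃ := hfree₂ q hq hqA₂
  have hz : ((A₂.erase x).erase y).card = 1 := by
    rw [Finset.card_erase_of_mem (by simp [hyx, hyA₂]), Finset.card_erase_of_mem hxA₂, hc₂]
  obtain ⟨z, hz⟩ := Finset.card_eq_one.mp hz
  obtain ⟨t, ht, htA₃, htz⟩ := exists_mem_sdiff_ne (A₁ := A₃) (L₁ := L₃) (by omega) z
  obtain ⟨w, hw, hwA₁, hwA₂, htw⟩ : ∃ w ∈ L₁, w ∉ A₁ ∧ w ∈ A₂ ∧ t ∉ A₂.erase w := by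
    have : t ∉ (A₂.erase x).erase y := by simp [hz, htz]
    by_cases e : t = y
    · exact ⟨y, hy, hyA₁, hyA₂, by simp [e]⟩
    · exact ⟨x, hx, hxA₁, hxA₂, fun hm => this (Finset.mem_erase.mpr ⟨e, hm⟩)⟩
  have key : ∀ r ∈ L₂, r ∉ A₂ → r ∈ A₃ → ∀ B₄ ⊆ L₄, B₄.card = 3 →
      Disjoint (insert t (A₃.erase r)) B₄ →
      ∃ B₁ B₂ B₃ B₄, IsPathColoring L₁ L₂ L₃ L₄ B₁ B₂ B₃ B₄ ∧ ¬ B₁ ⊆ A₁ := by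
    intro r hr hrA₂ hrA₃ B₄ hB₄ hB₄c hB₄d
    refine h.exists_recolor_of_exchange hw hwA₁ hwA₂ hr hrA₂ (insert_erase_subset hA₃ ht) hB₄
      ((card_insert_erase hrA₃ htA₃).trans hc₃) hB₄c ?_ hB₄d
    rw [Finset.disjoint_left]
    grind
  by_cases htA₄ : t ∈ A₄
  · obtain ⟨r, hr, hrA₂, hrA₃, m, hm, hmA₄, hmr⟩ : ∃ r ∈ L₂, r ∉ A₂ ∧ r ∈ A₃ ∧
        ∃ m ∈ L₄, m ∉ A₄ ∧ m ∉ A₃.erase r := by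
      by_cases hfree₄ : ∃ m ∈ L₄, m ∉ A₄ ∧ m ∉ A₃
      · obtain ⟨m, hm, hmA₄, hmA₃⟩ := hfree₄
        exact ⟨p, hp, hpA₂, hpA₃, m, hm, hmA₄, fun hm' => hmA₃ (Finset.mem_of_mem_erase hm')⟩
      push Not at hfree₄
      have ho : ((A₃.erase p).erase q).card = 1 := by
        rw [Finset.card_erase_of_mem (by simp [hqp, hqA₃]), Finset.card_erase_of_mem hpA₃, hc₃]
      obtain ⟨o, ho⟩ := Finset.card_eq_one.mp ho
      obtain ⟨m, hm, hmA₄, hmo⟩ := exists_mem_sdiff_ne (A₁ := A₄) (L₁ := L₄) (by omega) o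
      have : m ∉ (A₃.erase p).erase q := by simp [ho, hmo]
      by_cases e : m = q
      · exact ⟨q, hq, hqA₂, hqA₃, m, hm, hmA₄, by simp [e]⟩
      · exact ⟨p, hp, hpA₂, hpA₃, m, hm, hmA₄, fun hm' => this (Finset.mem_erase.mpr ⟨e, hm'⟩)⟩
    refine key r hr hrA₂ hrA₃ _ (insert_erase_subset (x := t) hA₄ hm)
      ((card_insert_erase htA₄ hmA₄).trans hc₄) ?_
    rw [Finset.disjoint_left]
    grind
  · refine key p hp hpA₂ hpA₃ A₄ hA₄ hc₄ ?_
    rw [Finset.disjoint_left]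
    grind

end

/-- A color `α` of the first vertex and a color set `B` of the third vertex extend to the first
two vertices, provided some color of `B` is in the list `K` of the first vertex or outside the
list `M` of the second one. -/
theorem exists_extension {K M B : Finset ℕ} (hK : K.card = 5) (hM : M.card = 8)
    (hB : B.card = 3) {α : ℕ} (hα : α ∈ K) (h : (∃ β ∈ K, β ∉ M ∨ β ∈ B) ∨ ∃ β ∈ B, β ∉ M) :
    ∃ C D, C ⊆ K ∧ D ⊆ M ∧ C.card = 3 ∧ D.card = 3 ∧ Disjoint C D ∧ Disjoint D B ∧ α ∈ C := by
  obtain ⟨β, hβ, hβ'⟩ : ∃ β ∈ K, (β ∉ M ∨ β ∈ B) ∨ ∃ γ ∈ B, γ ∉ M := by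
    rcases h with ⟨β, hβ, h⟩ | h
    · exact ⟨β, hβ, Or.inl h⟩
    · exact ⟨α, hα, Or.inr h⟩
  obtain ⟨C, hC, hCK, hCc⟩ := Finset.exists_subsuperset_card_eq (s := {α, β}) (t := K) (n := 3)
    (by simp [Finset.insert_subset_iff, hα, hβ]) (Finset.card_le_two.trans (by norm_num))
    (by omega)
  have hβC : β ∈ C := hC (by simp)
  have hle : (M ∩ (C ∪ B)).card ≤ 5 := by
    have hu := Finset.card_union_add_card_inter C B
    have hout : ∀ {c}, c ∈ C ∪ B → c ∉ M → (M ∩ (C ∪ B)).card < (C ∪ B).card := fun hc hcM =>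
      Finset.card_lt_card (Finset.ssubset_iff_subset_ne.mpr ⟨Finset.inter_subset_right,
        fun e => hcM (Finset.mem_inter.mp (e ▸ hc)).1⟩)
    rcases hβ' with (hβM | hβB) | ⟨γ, hγB, hγM⟩
    · have := hout (Finset.mem_union_left B hβC) hβM
      omega
    · have := Finset.card_pos.mpr ⟨β, Finset.mem_inter.mpr ⟨hβC, hβB⟩⟩
      have := Finset.card_le_card (Finset.inter_subset_right (s₁ := M) (s₂ := C ∪ B))
      omega
    · have := hout (Finset.mem_union_right C hγB) hγM
      omega
  have hD : 3 ≤ (M \ (C ∪ B)).card := by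
    have := Finset.card_sdiff_add_card_inter M (C ∪ B)
    omega
  obtain ⟨D, hDM, hDc⟩ := Finset.exists_subset_card_eq hD
  obtain ⟨hDM, hDd⟩ := Finset.subset_sdiff.mp hDM
  rw [Finset.disjoint_union_right] at hDd
  exact ⟨C, D, hCK, hDM, hCc, hDc, hDd.1.symm, hDd.2, hC (by simp)⟩

theorem stmt_5 (L : Fin 6 → Finset ℕ)
    (h1 : (L 0).card = 5) (h2 : (L 1).card = 8) (h3 : (L 2).card = 5) (h4 : (L 3).card = 5)
    (h5 : (L 4).card = 5) (h6 : (L 5).card = 5)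
    (hsub : HasL3ColoringOn (SimpleGraph.pathGraph 6) L {2, 3, 4, 5}) :
    (∃ φ, IsL3Coloring (SimpleGraph.pathGraph 6) L φ) ∧
    ∀ α ∈ L 0,
      ∃ φ, IsL3Coloring (SimpleGraph.pathGraph 6) L φ ∧ α ∈ φ 0 := by
  have main : ∀ α ∈ L 0, ∃ φ, IsL3Coloring (SimpleGraph.pathGraph 6) L φ ∧ α ∈ φ 0 := by
    intro α hα
    obtain ⟨ψ, hψL, hψc, hψd⟩ := hsub
    have hψ : IsPathColoring (L 2) (L 3) (L 4) (L 5) (ψ 2) (ψ 3) (ψ 4) (ψ 5) :=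
      ⟨⟨hψL _ (by simp), hψL _ (by simp), hψL _ (by simp), hψL _ (by simp)⟩,
        ⟨hψc _ (by simp), hψc _ (by simp), hψc _ (by simp), hψc _ (by simp)⟩,
        hψd _ (by simp) _ (by simp) (by simp [SimpleGraph.pathGraph_adj]),
        hψd _ (by simp) _ (by simp) (by simp [SimpleGraph.pathGraph_adj]),
        hψd _ (by simp) _ (by simp) (by simp [SimpleGraph.pathGraph_adj])⟩
    obtain ⟨B₁, B₂, B₃, B₄, hB, hgood⟩ : ∃ B₁ B₂ B₃ B₄,
        IsPathColoring (L 2) (L 3) (L 4) (L 5) B₁ B₂ B₃ B₄ ∧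
          ((∃ β ∈ L 0, β ∉ L 1 ∨ β ∈ B₁) ∨ ∃ β ∈ B₁, β ∉ L 1) := by
      by_cases hg : (∃ β ∈ L 0, β ∉ L 1 ∨ β ∈ ψ 2) ∨ ∃ β ∈ ψ 2, β ∉ L 1
      · exact ⟨_, _, _, _, hψ, hg⟩
      push Not at hg
      obtain ⟨hg₁, hg₂⟩ := hg
      have hcover : L 0 ∪ ψ 2 = L 1 := by
        apply Finset.eq_of_subset_of_card_le
        · exact Finset.union_subset (fun β hβ => (hg₁ β hβ).1) hg₂
        · rw [Finset.card_union_of_disjoint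
            (Finset.disjoint_left.mpr fun β hβ => (hg₁ β hβ).2), h1, h2, hψ.2.1.1]
      obtain ⟨B₁, B₂, B₃, B₄, hB, hne⟩ := hψ.exists_recolor h3 h4 h5 h6
      obtain ⟨β, hβ, hβψ⟩ := Finset.not_subset.mp hne
      refine ⟨B₁, B₂, B₃, B₄, hB, ?_⟩
      by_cases hβ₀ : β ∈ L 0
      · exact Or.inl ⟨β, hβ₀, Or.inr hβ⟩
      · exact Or.inr ⟨β, hβ, by simp [← hcover, hβ₀, hβψ]⟩
    obtain ⟨⟨s₁, s₂, s₃, s₄⟩, ⟨c₁, c₂, c₃, c₄⟩, d₁₂, d₂₃, d₃₄⟩ := hB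
    obtain ⟨C, D, sC, sD, cC, cD, dCD, dD, hαC⟩ := exists_extension h1 h2 c₁ hα hgood
    refine ⟨![C, D, B₁, B₂, B₃, B₄], ⟨?_, ?_, ?_⟩, hαC⟩
    · intro v
      fin_cases v <;> assumption
    · intro v
      fin_cases v <;> assumption
    · intro u v huv
      rw [SimpleGraph.pathGraph_adj] at huv
      fin_cases u <;> fin_cases v <;> first
        | (exfalso; revert huv; decide)
        | assumption
        | (apply Disjoint.symm; assumption)
  obtain ⟨α, hα⟩ : (L 0).Nonempty := Finset.card_pos.mp (by omega)
  obtain ⟨φ, hφ, -⟩ := main α hα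
  exact ⟨⟨φ, hφ⟩, main⟩
end

section
/- Let P = v_1 v_2 … v_k be a path on k vertices with 5 ≤ k ≤ 7, and let L be a list assignment for P such that |L(v_3)| = 8, |L(v_i)| = 5 for every i ∈ {1, …, k} with i ≠ 3, and the graph P − v_3 (the disjoint union of the path v_1 v_2 and the path v_4 … v_k) has an (L:3)-coloring. Then P is (L:3)-colorable. -/
open Finset

/-- If `C` is not contained in `L`, then `L` has a `3`-subset that avoids `C` and contains a
prescribed element outside `C`. -/
lemma exists_mem_powersetCard_disjoint_mem {L C : Finset ℕ} (hL : L.card = 5) (hC : C.card = 3)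
    {x z : ℕ} (hxC : x ∈ C) (hxL : x ∉ L) (hzL : z ∈ L) (hzC : z ∉ C) :
    ∃ A ∈ powersetCard 3 L, Disjoint A C ∧ z ∈ A := by
  have hinter : (C ∩ L).card ≤ 2 := by
    have hsub : C ∩ L ⊆ C.erase x := by grind
    have := card_le_card hsub
    rw [card_erase_of_mem hxC] at this
    omega
  have hcard : 3 ≤ (L \ C).card := by
    rw [card_sdiff]
    omega
  obtain ⟨A, hzA, hA, hA3⟩ := exists_subsuperset_card_eq (s := {z}) (t := L \ C) (n := 3)
    (by simp [hzL, hzC]) (by simp) hcard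
  refine ⟨A, mem_powersetCard.2 ⟨fun y hy => (mem_sdiff.1 (hA hy)).1, hA3⟩, ?_, hzA (by simp)⟩
  exact disjoint_left.2 fun y hy => (mem_sdiff.1 (hA hy)).2

lemma exists_mem_powersetCard_disjoint {L C : Finset ℕ} (hL : L.card = 5) (hC : C.card = 3)
    {x : ℕ} (hxC : x ∈ C) (hxL : x ∉ L) : ∃ A ∈ powersetCard 3 L, Disjoint A C := by
  obtain ⟨z, hzL, hzC⟩ := exists_mem_notMem_of_card_lt_card (s := C) (t := L) (by omega)
  obtain ⟨A, hA, hAC, -⟩ := exists_mem_powersetCard_disjoint_mem hL hC hxC hxL hzL hzC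
  exact ⟨A, hA, hAC⟩

/-- A `3`-set disjoint from a `3`-subset of a `5`-set is not contained in that `5`-set. -/
lemma exists_mem_notMem_of_disjoint {L A C : Finset ℕ} (hL : L.card = 5)
    (hA : A ∈ powersetCard 3 L) (hC : C.card = 3) (h : Disjoint A C) : ∃ x ∈ C, x ∉ L := by
  rw [mem_powersetCard] at hA
  by_contra! hCL
  have := card_le_card (union_subset hA.1 hCL)
  rw [card_union_of_disjoint h] at this
  omega

/-- If two adjacent vertices with lists of size `5` can be colored, then they can be colored so
that any prescribed color is used at the second one. -/
lemma exists_coloring_edge_mem {L₁ L₂ A₁ A₂ : Finset ℕ} (h₁ : L₁.card = 5) (h₂ : L₂.card = 5)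
    (hA₁ : A₁ ∈ powersetCard 3 L₁) (hA₂ : A₂ ∈ powersetCard 3 L₂) (h : Disjoint A₁ A₂)
    {c : ℕ} (hc : c ∈ L₂) :
    ∃ B₁ ∈ powersetCard 3 L₁, ∃ B₂ ∈ powersetCard 3 L₂, Disjoint B₁ B₂ ∧ c ∈ B₂ := by
  rw [mem_powersetCard] at hA₂
  obtain ⟨x, hx, hxL⟩ := exists_mem_notMem_of_disjoint h₁ hA₁ hA₂.2 h
  obtain ⟨B, hB, hBL, hB3⟩ := exists_subsuperset_card_eq (s := {c, x}) (t := L₂) (n := 3)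
    (by simp [insert_subset_iff, hc, hA₂.1 hx]) (card_le_two.trans (by norm_num)) (by omega)
  obtain ⟨B₁, hB₁, hdisj⟩ := exists_mem_powersetCard_disjoint h₁ hB3 (hB (by simp)) hxL
  exact ⟨B₁, hB₁, B, mem_powersetCard.2 ⟨hBL, hB3⟩, hdisj, hB (by simp)⟩

/-- A coloring of a path on four vertices with lists of size `5` can be changed at its first
vertex. -/
lemma exists_coloring_path_ne {L₁ L₂ L₃ L₄ A₁ A₂ A₃ A₄ : Finset ℕ}
    (h₁ : L₁.card = 5) (h₂ : L₂.card = 5) (h₃ : L₃.card = 5) (h₄ : L₄.card = 5)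
    (hA₁ : A₁ ∈ powersetCard 3 L₁) (hA₂ : A₂ ∈ powersetCard 3 L₂)
    (hA₃ : A₃ ∈ powersetCard 3 L₃) (hA₄ : A₄ ∈ powersetCard 3 L₄)
    (h₁₂ : Disjoint A₁ A₂) (h₂₃ : Disjoint A₂ A₃) (h₃₄ : Disjoint A₃ A₄) :
    ∃ B₁ ∈ powersetCard 3 L₁, ∃ B₂ ∈ powersetCard 3 L₂, ∃ B₃ ∈ powersetCard 3 L₃,
      ∃ B₄ ∈ powersetCard 3 L₄, Disjoint B₁ B₂ ∧ Disjoint B₂ B₃ ∧ Disjoint B₃ B₄ ∧ B₁ ≠ A₁ := by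
  have hA₁' := mem_powersetCard.1 hA₁
  have hA₂' := mem_powersetCard.1 hA₂
  have hA₃' := mem_powersetCard.1 hA₃
  obtain ⟨c, hcA, hcL⟩ := exists_mem_notMem_of_disjoint h₁ hA₁ hA₂'.2 h₁₂
  obtain ⟨x, hxA, hxL⟩ := exists_mem_notMem_of_disjoint h₄ hA₄ hA₃'.2 h₃₄.symm
  -- It suffices to free some color of `L₁ \ A₁` at the second vertex.
  have key : ∀ z ∈ L₁, z ∉ A₁ → ∀ B₂ ∈ powersetCard 3 L₂, c ∈ B₂ → z ∉ B₂ →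
      ∀ B₃ ∈ powersetCard 3 L₃, Disjoint B₂ B₃ → x ∈ B₃ →
      ∃ B₁ ∈ powersetCard 3 L₁, ∃ B₂ ∈ powersetCard 3 L₂, ∃ B₃ ∈ powersetCard 3 L₃,
        ∃ B₄ ∈ powersetCard 3 L₄,
          Disjoint B₁ B₂ ∧ Disjoint B₂ B₃ ∧ Disjoint B₃ B₄ ∧ B₁ ≠ A₁ := by
    intro z hzL hzA B₂ hB₂ hcB hzB B₃ hB₃ h₂₃ hxB
    obtain ⟨B₁, hB₁, h₁₂, hz⟩ := exists_mem_powersetCard_disjoint_mem h₁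
      (mem_powersetCard.1 hB₂).2 hcB hcL hzL hzB
    obtain ⟨B₄, hB₄, h₄₃⟩ := exists_mem_powersetCard_disjoint h₄
      (mem_powersetCard.1 hB₃).2 hxB hxL
    exact ⟨B₁, hB₁, B₂, hB₂, B₃, hB₃, B₄, hB₄, h₁₂, h₂₃, h₄₃.symm, fun h => hzA (h ▸ hz)⟩
  have hcard₁ : (L₁ \ A₁).card = 2 := by rw [card_sdiff_of_subset hA₁'.1]; omega
  have hcard₂ : (L₂ \ A₂).card = 2 := by rw [card_sdiff_of_subset hA₂'.1]; omega
  have hcard₃ : (L₃ \ A₃).card = 2 := by rw [card_sdiff_of_subset hA₃'.1]; omega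
  by_cases hz : ∃ z ∈ L₁, z ∉ A₁ ∧ z ∉ A₂
  · obtain ⟨z, hzL, hzA₁, hzA₂⟩ := hz
    exact key z hzL hzA₁ A₂ hA₂ hcA hzA₂ A₃ hA₃ h₂₃ hxA
  push Not at hz
  have hcd : ∀ d ∈ L₂, d ∉ A₂ → ∀ u ∈ L₁, u ∉ A₁ →
      ({c, d, u} : Finset ℕ) ∈ powersetCard 3 L₂ := by
    intro d hdL hdA u huL huA
    have huA₂ := hz u huL huA
    refine mem_powersetCard.2 ⟨?_, card_eq_three.2 ⟨c, d, u, ?_, ?_, ?_, rfl⟩⟩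
    · simp [insert_subset_iff, hA₂'.1 hcA, hdL, hA₂'.1 huA₂]
    all_goals grind
  by_cases hd : ∃ d ∈ L₂, d ∉ A₂ ∧ d ∉ A₃
  · obtain ⟨d, hdL, hdA₂, hdA₃⟩ := hd
    obtain ⟨a, b, hab, hL₁⟩ := card_eq_two.1 hcard₁
    have ha : a ∈ L₁ \ A₁ := by simp [hL₁]
    have hb : b ∈ L₁ \ A₁ := by simp [hL₁]
    rw [mem_sdiff] at ha hb
    have haA := hz a ha.1 ha.2
    have hbA := hz b hb.1 hb.2
    refine key a ha.1 ha.2 _ (hcd d hdL hdA₂ b hb.1 hb.2) (by simp) (by grind) A₃ hA₃ ?_ hxA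
    rw [disjoint_left] at h₂₃ ⊢
    grind
  push Not at hd
  obtain ⟨d, hdm, hdx⟩ := exists_mem_ne (by omega : 1 < (L₂ \ A₂).card) x
  obtain ⟨g, hgm, hgc⟩ := exists_mem_ne (by omega : 1 < (L₃ \ A₃).card) c
  obtain ⟨u, hum, hug⟩ := exists_mem_ne (by omega : 1 < (L₁ \ A₁).card) g
  obtain ⟨z, hzm, hzu⟩ := exists_mem_ne (by omega : 1 < (L₁ \ A₁).card) u
  rw [mem_sdiff] at hdm hgm hum hzm
  have hdA₃ := hd d hdm.1 hdm.2
  have huA₂ := hz u hum.1 hum.2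
  have hzA₂ := hz z hzm.1 hzm.2
  refine key z hzm.1 hzm.2 _ (hcd d hdm.1 hdm.2 u hum.1 hum.2) (by simp) (by grind)
    (insert g (A₃.erase d)) (mem_powersetCard.2 ⟨?_, ?_⟩) ?_ (by grind)
  · have := hA₃'.1
    grind
  · rw [card_insert_of_notMem (by grind), card_erase_of_mem hdA₃]
    omega
  · rw [disjoint_left] at h₂₃ ⊢
    grind

/-- A `3`-subset of an `8`-set `L` avoiding `A` and `B` exists unless `A` and `B` are disjoint
subsets of `L`. -/
lemma exists_mem_powersetCard_disjoint_disjoint {L A B : Finset ℕ} (hL : L.card = 8)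
    (hA : A.card = 3) (hB : B.card = 3)
    (h : (∃ x ∈ A, x ∉ L) ∨ (∃ x ∈ B, x ∉ L) ∨ ∃ x ∈ A, x ∈ B) :
    ∃ C ∈ powersetCard 3 L, Disjoint A C ∧ Disjoint C B := by
  have hAB : ((A ∪ B) ∩ L).card ≤ 5 := by
    have hun := card_union_add_card_inter A B
    have hout : ∀ x ∈ A ∪ B, x ∉ L → ((A ∪ B) ∩ L).card ≤ 5 := by
      intro x hx hxL
      have hsub : (A ∪ B) ∩ L ⊆ (A ∪ B).erase x := by grind
      have := card_le_card hsub
      rw [card_erase_of_mem hx] at this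
      omega
    rcases h with ⟨x, hx, hxL⟩ | ⟨x, hx, hxL⟩ | ⟨x, hxA, hxB⟩
    · exact hout x (mem_union_left _ hx) hxL
    · exact hout x (mem_union_right _ hx) hxL
    · have : 0 < (A ∩ B).card := card_pos.2 ⟨x, mem_inter.2 ⟨hxA, hxB⟩⟩
      have := card_le_card (inter_subset_left : (A ∪ B) ∩ L ⊆ A ∪ B)
      omega
  have hcard : 3 ≤ (L \ (A ∪ B)).card := by
    rw [card_sdiff]
    omega
  obtain ⟨C, hC, hC3⟩ := exists_subset_card_eq hcard
  refine ⟨C, mem_powersetCard.2 ⟨hC.trans sdiff_subset, hC3⟩, ?_, ?_⟩ <;>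
  · rw [disjoint_left]
    grind

/-- The case of a path on exactly seven vertices, with the vertices given one by one. -/
lemma exists_coloring_path_seven {L₁ L₂ L₃ L₄ L₅ L₆ L₇ A₁ A₂ A₄ A₅ A₆ A₇ : Finset ℕ}
    (h₁ : L₁.card = 5) (h₂ : L₂.card = 5) (h₃ : L₃.card = 8) (h₄ : L₄.card = 5)
    (h₅ : L₅.card = 5) (h₆ : L₆.card = 5) (h₇ : L₇.card = 5)
    (hA₁ : A₁ ∈ powersetCard 3 L₁) (hA₂ : A₂ ∈ powersetCard 3 L₂)
    (hA₄ : A₄ ∈ powersetCard 3 L₄) (hA₅ : A₅ ∈ powersetCard 3 L₅)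
    (hA₆ : A₆ ∈ powersetCard 3 L₆) (hA₇ : A₇ ∈ powersetCard 3 L₇)
    (h₁₂ : Disjoint A₁ A₂) (h₄₅ : Disjoint A₄ A₅) (h₅₆ : Disjoint A₅ A₆)
    (h₆₇ : Disjoint A₆ A₇) :
    ∃ B₁ ∈ powersetCard 3 L₁, ∃ B₂ ∈ powersetCard 3 L₂, ∃ B₃ ∈ powersetCard 3 L₃,
      ∃ B₄ ∈ powersetCard 3 L₄, ∃ B₅ ∈ powersetCard 3 L₅, ∃ B₆ ∈ powersetCard 3 L₆,
        ∃ B₇ ∈ powersetCard 3 L₇, Disjoint B₁ B₂ ∧ Disjoint B₂ B₃ ∧ Disjoint B₃ B₄ ∧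
          Disjoint B₄ B₅ ∧ Disjoint B₅ B₆ ∧ Disjoint B₆ B₇ := by
  -- It suffices to find a coloring of the tail for which some color of `L₂` leaves room at `L₃`.
  have key : ∀ B₄ ∈ powersetCard 3 L₄, ∀ B₅ ∈ powersetCard 3 L₅, ∀ B₆ ∈ powersetCard 3 L₆,
      ∀ B₇ ∈ powersetCard 3 L₇, Disjoint B₄ B₅ → Disjoint B₅ B₆ → Disjoint B₆ B₇ →
      (∃ c ∈ L₂, c ∉ L₃ ∨ (∃ x ∈ B₄, x ∉ L₃) ∨ c ∈ B₄) →
      ∃ B₁ ∈ powersetCard 3 L₁, ∃ B₂ ∈ powersetCard 3 L₂, ∃ B₃ ∈ powersetCard 3 L₃,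
        ∃ B₄ ∈ powersetCard 3 L₄, ∃ B₅ ∈ powersetCard 3 L₅, ∃ B₆ ∈ powersetCard 3 L₆,
          ∃ B₇ ∈ powersetCard 3 L₇, Disjoint B₁ B₂ ∧ Disjoint B₂ B₃ ∧ Disjoint B₃ B₄ ∧
            Disjoint B₄ B₅ ∧ Disjoint B₅ B₆ ∧ Disjoint B₆ B₇ := by
    rintro B₄ hB₄ B₅ hB₅ B₆ hB₆ B₇ hB₇ h₄₅ h₅₆ h₆₇ ⟨c, hc, h⟩
    obtain ⟨B₁, hB₁, B₂, hB₂, h₁₂, hcB⟩ := exists_coloring_edge_mem h₁ h₂ hA₁ hA₂ h₁₂ hc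
    obtain ⟨B₃, hB₃, h₂₃, h₃₄⟩ := exists_mem_powersetCard_disjoint_disjoint h₃
      (mem_powersetCard.1 hB₂).2 (mem_powersetCard.1 hB₄).2
      (h.imp (fun h => ⟨c, hcB, h⟩) (Or.imp_right fun h => ⟨c, hcB, h⟩))
    exact ⟨B₁, hB₁, B₂, hB₂, B₃, hB₃, B₄, hB₄, B₅, hB₅, B₆, hB₆, B₇, hB₇,
      h₁₂, h₂₃, h₃₄, h₄₅, h₅₆, h₆₇⟩
  obtain ⟨c₀, hc₀⟩ : L₂.Nonempty := card_pos.1 (by omega)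
  by_cases hL : L₂ ⊆ L₃
  · have hcard : (L₃ \ L₂).card = 3 := by rw [card_sdiff_of_subset hL]; omega
    have tail : ∀ B ∈ powersetCard 3 L₄, B ≠ L₃ \ L₂ →
        ∃ c ∈ L₂, c ∉ L₃ ∨ (∃ x ∈ B, x ∉ L₃) ∨ c ∈ B := by
      intro B hB hne
      obtain ⟨x, hxB, hx⟩ : ∃ x ∈ B, x ∉ L₃ \ L₂ := by
        by_contra! hsub
        exact hne (eq_of_subset_of_card_le hsub (by rw [hcard, (mem_powersetCard.1 hB).2]))
      by_cases hxL : x ∈ L₃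
      · exact ⟨x, by grind, Or.inr (Or.inr hxB)⟩
      · exact ⟨c₀, hc₀, Or.inr (Or.inl ⟨x, hxB, hxL⟩)⟩
    by_cases hA : A₄ = L₃ \ L₂
    · obtain ⟨B₄, hB₄, B₅, hB₅, B₆, hB₆, B₇, hB₇, h₄₅, h₅₆, h₆₇, hne⟩ :=
        exists_coloring_path_ne h₄ h₅ h₆ h₇ hA₄ hA₅ hA₆ hA₇ h₄₅ h₅₆ h₆₇
      exact key B₄ hB₄ B₅ hB₅ B₆ hB₆ B₇ hB₇ h₄₅ h₅₆ h₆₇ (tail B₄ hB₄ (hA ▸ hne))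
    · exact key A₄ hA₄ A₅ hA₅ A₆ hA₆ A₇ hA₇ h₄₅ h₅₆ h₆₇ (tail A₄ hA₄ hA)
  · obtain ⟨c, hc, hcL⟩ := not_subset.1 hL
    exact key A₄ hA₄ A₅ hA₅ A₆ hA₆ A₇ hA₇ h₄₅ h₅₆ h₆₇ ⟨c, hc, Or.inl hcL⟩

theorem stmt_6 (k : ℕ) (hk5 : 5 ≤ k) (hk7 : k ≤ 7) (L : Fin k → Finset ℕ)
    (h3 : (L ⟨2, by omega⟩).card = 8)
    (hother : ∀ i : Fin k, i.val ≠ 2 → (L i).card = 5)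
    (hsub : HasL3ColoringOn (SimpleGraph.pathGraph k) L {i : Fin k | i.val ≠ 2}) :
    ∃ φ, IsL3Coloring (SimpleGraph.pathGraph k) L φ := by
  obtain ⟨φ, hφL, hφ3, hφ⟩ := hsub
  obtain ⟨N, hN⟩ : ∃ N, ∀ i, ∀ x ∈ L i, x < N :=
    ⟨univ.sup (fun i => (L i).sup id) + 1, fun i x hx => Nat.lt_succ_of_le <|
      (le_sup (f := id) hx).trans (le_sup (f := fun i => (L i).sup id) (mem_univ i))⟩
  -- Extend the path to seven vertices, with fresh colors at the new vertices.
  let M : ℕ → Finset ℕ := fun i =>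
    if h : i < k then L ⟨i, h⟩ else Ico (N + 5 * i) (N + 5 * i + 5)
  let A : ℕ → Finset ℕ := fun i =>
    if h : i < k then φ ⟨i, h⟩ else Ico (N + 5 * i) (N + 5 * i + 3)
  have hM : ∀ i, i ≠ 2 → (M i).card = 5 := by
    intro i hi
    by_cases h : i < k
    · simpa [M, h] using hother ⟨i, h⟩ hi
    · simp [M, h]
  have hA : ∀ i, i ≠ 2 → A i ∈ powersetCard 3 (M i) := by
    intro i hi
    rw [mem_powersetCard]
    by_cases h : i < k
    · simpa [M, A, h] using And.intro (hφL ⟨i, h⟩ hi) (hφ3 ⟨i, h⟩ hi)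
    · simp only [M, A, h, dite_false]
      exact ⟨Ico_subset_Ico_right (by omega), by simp⟩
  have hdisj : ∀ i, i ≠ 2 → i + 1 ≠ 2 → Disjoint (A i) (A (i + 1)) := by
    intro i hi hi'
    by_cases h' : i + 1 < k
    · have h : i < k := by omega
      simp only [A, h, h', dite_true]
      exact hφ _ hi _ hi' (by simp [SimpleGraph.pathGraph_adj])
    · rw [disjoint_left]
      intro x hx hx'
      simp only [A, h', dite_false, mem_Ico] at hx'
      by_cases h : i < k
      · simp only [A, h, dite_true] at hx
        have := hN ⟨i, h⟩ x (hφL ⟨i, h⟩ hi hx)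
        omega
      · simp only [A, h, dite_false, mem_Ico] at hx
        omega
  have hM2 : (M 2).card = 8 := by simpa [M, show 2 < k by omega] using h3
  obtain ⟨B₁, hB₁, B₂, hB₂, B₃, hB₃, B₄, hB₄, B₅, hB₅, B₆, hB₆, B₇, hB₇,
      h₁₂, h₂₃, h₃₄, h₄₅, h₅₆, h₆₇⟩ :=
    exists_coloring_path_seven (hM 0 (by omega)) (hM 1 (by omega)) hM2 (hM 3 (by omega))
      (hM 4 (by omega)) (hM 5 (by omega)) (hM 6 (by omega)) (hA 0 (by omega)) (hA 1 (by omega))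
      (hA 3 (by omega)) (hA 4 (by omega)) (hA 5 (by omega)) (hA 6 (by omega))
      (hdisj 0 (by omega) (by omega)) (hdisj 3 (by omega) (by omega))
      (hdisj 4 (by omega) (by omega)) (hdisj 5 (by omega) (by omega))
  let B : Fin 7 → Finset ℕ := ![B₁, B₂, B₃, B₄, B₅, B₆, B₇]
  have hB : ∀ i : Fin 7, B i ∈ powersetCard 3 (M i) := by
    intro i
    fin_cases i <;> assumption
  have hBdisj : ∀ i j : Fin 7, i.val + 1 = j.val → Disjoint (B i) (B j) := by
    intro i j hij
    obtain ⟨i, hi⟩ := i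
    obtain ⟨j, hj⟩ := j
    obtain rfl : i + 1 = j := hij
    have : i < 6 := by omega
    interval_cases i <;> assumption
  have hBL : ∀ i : Fin k, B (Fin.castLE hk7 i) ∈ powersetCard 3 (L i) := fun i => by
    simpa [M] using hB (Fin.castLE hk7 i)
  refine ⟨fun i => B (Fin.castLE hk7 i), fun i => (mem_powersetCard.1 (hBL i)).1,
    fun i => (mem_powersetCard.1 (hBL i)).2, fun u v huv => ?_⟩
  rcases SimpleGraph.pathGraph_adj.1 huv with h | h
  · exact hBdisj _ _ h
  · exact (hBdisj _ _ h).symm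
end

section
/- Let C = v_1 v_2 v_3 v_4 v_5 v_6 be a cycle on six vertices and let L be a list assignment for C such that |L(v_i)| ≥ 5 for 1 ≤ i ≤ 6. Suppose there exists a set S ⊆ V(C) with |S| = 2 such that |L(u)| = 8 for every u ∈ S and the graph C − S obtained by deleting the two vertices of S is (L:3)-colorable. Then C is (L:3)-colorable. -/
open Finset

/-- A vertex with list `L` of size eight cannot avoid the triples `A` and `B` of its neighbours. -/
def Blocked (L A B : Finset ℕ) : Prop :=
  A ⊆ L ∧ B ⊆ L ∧ Disjoint A B

lemma Blocked.symm {L A B : Finset ℕ} (h : Blocked L A B) : Blocked L B A :=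
  ⟨h.2.1, h.1, h.2.2.symm⟩

lemma exists_triple_superset {D L : Finset ℕ} (hDL : D ⊆ L) (hD : D.card ≤ 3)
    (hL : 3 ≤ L.card) : ∃ A ∈ L.powersetCard 3, D ⊆ A := by
  obtain ⟨A, h₁, h₂, h₃⟩ := exists_subsuperset_card_eq hDL hD hL
  exact ⟨A, mem_powersetCard.2 ⟨h₂, h₃⟩, h₁⟩

/-- A triple with an element outside a list of size five leaves at least three colors of it. -/
lemma three_le_card_sdiff {X A : Finset ℕ} {u : ℕ} (hX : 5 ≤ X.card) (hA : A.card = 3)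
    (hu : u ∈ A) (huX : u ∉ X) : 3 ≤ (X \ A).card := by
  have h : X \ A.erase u = X \ A := by
    ext x
    simp only [mem_sdiff, mem_erase]
    grind
  have h₁ := le_card_sdiff (A.erase u) X
  rw [h, card_erase_of_mem hu] at h₁
  omega

lemma inter_eq_erase {X B : Finset ℕ} {u : ℕ} (hB : B.card = 3) (hXB : (X ∩ B).card = 2)
    (hu : u ∈ B) (huX : u ∉ X) : X ∩ B = B.erase u := by
  refine eq_of_subset_of_card_le (fun x hx => ?_) (by rw [card_erase_of_mem hu]; omega)
  rw [mem_inter] at hx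
  exact mem_erase.2 ⟨fun h => huX (h ▸ hx.1), hx.2⟩

lemma exists_triple_of_not_blocked {L A B : Finset ℕ} (hL : L.card = 8) (hA : A.card = 3)
    (hB : B.card = 3) (h : ¬ Blocked L A B) :
    ∃ C ∈ L.powersetCard 3, Disjoint C A ∧ Disjoint C B := by
  have h₃ : 3 ≤ (L \ (A ∪ B)).card := by
    have h₁ := card_sdiff_add_card_inter L (A ∪ B)
    have h₂ := card_union_add_card_inter A B
    have h₄ : (L ∩ (A ∪ B)).card ≤ (A ∪ B).card := card_le_card inter_subset_right
    by_contra hlt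
    apply h
    have h₅ : L ∩ (A ∪ B) = A ∪ B := eq_of_subset_of_card_le inter_subset_right (by omega)
    have h₆ : (A ∩ B).card = 0 := by rw [h₅] at h₁; omega
    have h₇ := inter_eq_right.1 h₅
    exact ⟨subset_union_left.trans h₇, subset_union_right.trans h₇,
      disjoint_iff_inter_eq_empty.2 (card_eq_zero.1 h₆)⟩
  obtain ⟨C, hC, -⟩ := exists_triple_superset (empty_subset _) (by simp) h₃
  rw [mem_powersetCard, subset_sdiff, disjoint_union_right] at hC
  exact ⟨C, mem_powersetCard.2 ⟨hC.1.1, hC.2⟩, hC.1.2⟩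

lemma exists_disjoint_triples_through {X Y : Finset ℕ} {c m n : ℕ} (hX : 5 ≤ X.card)
    (hY : 5 ≤ Y.card) (hc : c ∈ X) (hcY : c ∉ Y) (hm : m ∈ X) (hn : n ∈ Y) (hmn : m ≠ n) :
    ∃ A ∈ X.powersetCard 3, ∃ B ∈ Y.powersetCard 3, Disjoint A B ∧ m ∈ A ∧ n ∈ B := by
  obtain ⟨A, hA, hDA⟩ := exists_triple_superset (D := {m, c}) (L := X.erase n)
    (by grind) (card_le_two.trans (by norm_num))
    (by have := pred_card_le_card_erase (s := X) (a := n); omega)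
  rw [mem_powersetCard] at hA
  have hnA : n ∉ A := fun h => by simpa using hA.1 h
  obtain ⟨B, hB, hnB⟩ := exists_triple_superset (D := {n}) (L := Y \ A) (by grind) (by simp)
    (three_le_card_sdiff hY hA.2 (hDA (by simp)) hcY)
  rw [mem_powersetCard, subset_sdiff] at hB
  exact ⟨A, mem_powersetCard.2 ⟨hA.1.trans (erase_subset _ _), hA.2⟩, B,
    mem_powersetCard.2 ⟨hB.1.1, hB.2⟩, hB.1.2.symm, hDA (by simp), hnB (by simp)⟩

/-- Two adjacent vertices with lists `P` and `Q` of size eight can be colored next to outer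
neighbors colored `A` and `B`, unless what remains of the two lists is the same set of size
five. -/
lemma exists_triples_of_adjacent {P Q A B : Finset ℕ} (hP : P.card = 8) (hQ : Q.card = 8)
    (hA : A.card = 3) (hB : B.card = 3) (h : ¬ (A ⊆ P ∧ B ⊆ Q ∧ P \ A = Q \ B)) :
    ∃ C ∈ P.powersetCard 3, ∃ D ∈ Q.powersetCard 3,
      Disjoint C A ∧ Disjoint D B ∧ Disjoint C D := by
  have hPA := le_card_sdiff A P
  have hQB := le_card_sdiff B Q
  suffices ∃ C ∈ (P \ A).powersetCard 3, ∃ D ∈ (Q \ B).powersetCard 3, Disjoint C D by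
    obtain ⟨C, hC, D, hD, hCD⟩ := this
    simp only [mem_powersetCard, subset_sdiff] at hC hD
    exact ⟨C, mem_powersetCard.2 ⟨hC.1.1, hC.2⟩, D, mem_powersetCard.2 ⟨hD.1.1, hD.2⟩,
      hC.1.2, hD.1.2, hCD⟩
  have key : ∀ {X Y : Finset ℕ}, 5 ≤ X.card → 5 ≤ Y.card → ¬ X ⊆ Y →
      ∃ C ∈ X.powersetCard 3, ∃ D ∈ Y.powersetCard 3, Disjoint C D := by
    intro X Y hX hY hXY
    obtain ⟨c, hc, hcY⟩ := not_subset.1 hXY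
    obtain ⟨n, hn⟩ := card_pos.1 (by omega : 0 < Y.card)
    obtain ⟨C, hC, D, hD, hCD, -⟩ :=
      exists_disjoint_triples_through hX hY hc hcY hc hn (fun e => hcY (e ▸ hn))
    exact ⟨C, hC, D, hD, hCD⟩
  by_cases h₁ : P \ A ⊆ Q \ B
  · by_cases h₂ : Q \ B ⊆ P \ A
    · have heq := h₁.antisymm h₂
      have h₆ : 6 ≤ (P \ A).card := by
        have e₁ := card_sdiff_add_card_inter P A
        have e₂ := card_sdiff_add_card_inter Q B
        have f₁ : (P ∩ A).card ≤ A.card := card_le_card inter_subset_right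
        have f₂ : (Q ∩ B).card ≤ B.card := card_le_card inter_subset_right
        by_contra hlt
        rw [← heq] at e₂
        exact h ⟨inter_eq_right.1 (eq_of_subset_of_card_le inter_subset_right (by omega)),
          inter_eq_right.1 (eq_of_subset_of_card_le inter_subset_right (by omega)), heq⟩
      obtain ⟨C, hC, -⟩ := exists_triple_superset (empty_subset (P \ A)) (by simp) (by omega)
      have hC' := mem_powersetCard.1 hC
      obtain ⟨D, hD, -⟩ := exists_triple_superset (empty_subset ((P \ A) \ C)) (by simp)
        (by have := le_card_sdiff C (P \ A); omega)
      rw [mem_powersetCard, subset_sdiff] at hD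
      exact ⟨C, hC, D, mem_powersetCard.2 ⟨heq ▸ hD.1.1, hD.2⟩, hD.1.2.symm⟩
    · obtain ⟨D, hD, C, hC, hDC⟩ := key (by omega) (by omega) h₂
      exact ⟨C, hC, D, hD, hDC.symm⟩
  · exact key (by omega) (by omega) h₁

lemma mem_swap_powersetCard {Y A : Finset ℕ} {a p : ℕ} (hA : A ∈ Y.powersetCard 3) (ha : a ∈ A)
    (hp : p ∈ Y) (hpA : p ∉ A) : insert p (A.erase a) ∈ Y.powersetCard 3 := by
  rw [mem_powersetCard] at hA ⊢
  refine ⟨insert_subset hp ((erase_subset _ _).trans hA.1), ?_⟩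
  rw [card_insert_of_notMem (by simp [hpA]), card_erase_of_mem ha, hA.2]

/-- If the color of the end vertex of a path is determined by the color `C` of the third vertex,
then the coloring is rigid near that end. -/
lemma path_end_rigid {X Y A B C : Finset ℕ} (hX : X.card = 5) (hA : A ∈ X.powersetCard 3)
    (hB : B ∈ Y.powersetCard 3) (hAB : Disjoint A B) (hBC : Disjoint B C)
    (huniq : ∀ A' ∈ X.powersetCard 3, ∀ B' ∈ Y.powersetCard 3, Disjoint A' B' → Disjoint B' C →
      A' = A) :
    X \ B = A ∧ (X ∩ B).card = 2 ∧ Y \ B ⊆ C := by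
  have hA' := mem_powersetCard.1 hA
  have hB' := mem_powersetCard.1 hB
  have hXB : X \ B = A := by
    refine Subset.antisymm (fun x hx => ?_) (subset_sdiff.2 ⟨hA'.1, hAB⟩)
    obtain ⟨A₁, hA₁, hxA₁⟩ := exists_triple_superset (singleton_subset_iff.2 hx) (by simp)
      (hA'.2 ▸ card_le_card (subset_sdiff.2 ⟨hA'.1, hAB⟩))
    rw [mem_powersetCard, subset_sdiff] at hA₁
    rw [← huniq A₁ (mem_powersetCard.2 ⟨hA₁.1.1, hA₁.2⟩) B hB hA₁.1.2 hBC]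
    exact hxA₁ (by simp)
  have hcard : (X ∩ B).card = 2 := by
    have := card_sdiff_add_card_inter X B
    rw [hXB] at this
    omega
  refine ⟨hXB, hcard, fun p hp => ?_⟩
  by_contra hpC
  obtain ⟨a, ha⟩ := card_pos.1 (by omega : 0 < (X ∩ B).card)
  obtain ⟨u, hu, huX⟩ : ∃ u ∈ B, u ∉ X := by
    by_contra! hcon
    rw [inter_eq_right.2 hcon] at hcard
    omega
  rw [mem_inter] at ha
  rw [mem_sdiff] at hp
  have hB₁ := mem_swap_powersetCard hB ha.2 hp.1 hp.2
  obtain ⟨A₁, hA₁, haA₁⟩ := exists_triple_superset (D := {a}) (L := X \ insert p (B.erase a))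
    (by grind) (by simp)
    (three_le_card_sdiff hX.ge (mem_powersetCard.1 hB₁).2 (u := u) (by grind) huX)
  rw [mem_powersetCard, subset_sdiff] at hA₁
  have := huniq A₁ (mem_powersetCard.2 ⟨hA₁.1.1, hA₁.2⟩) _ hB₁ hA₁.1.2
    (by
      rw [disjoint_insert_left]
      exact ⟨hpC, hBC.mono_left (erase_subset _ _)⟩)
  exact disjoint_left.1 hAB (this ▸ haA₁ (by simp)) ha.2

/-- A colorable path on four vertices has a coloring of its ends that extends over an edge with
lists `P` and `Q` joining them. -/
lemma exists_path_four {P Q X Y Z W A B C D : Finset ℕ}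
    (hX : X.card = 5) (hY : Y.card = 5) (hZ : Z.card = 5) (hW : W.card = 5)
    (hA : A ∈ X.powersetCard 3) (hB : B ∈ Y.powersetCard 3) (hC : C ∈ Z.powersetCard 3)
    (hD : D ∈ W.powersetCard 3) (hAB : Disjoint A B) (hBC : Disjoint B C) (hCD : Disjoint C D) :
    ∃ A ∈ X.powersetCard 3, ∃ B ∈ Y.powersetCard 3, ∃ C ∈ Z.powersetCard 3,
      ∃ D ∈ W.powersetCard 3, Disjoint A B ∧ Disjoint B C ∧ Disjoint C D ∧
        ¬ (D ⊆ P ∧ A ⊆ Q ∧ P \ D = Q \ A) := by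
  by_contra! H
  have rigid₁ : ∀ A ∈ X.powersetCard 3, ∀ B ∈ Y.powersetCard 3, ∀ C ∈ Z.powersetCard 3,
      ∀ D ∈ W.powersetCard 3, Disjoint A B → Disjoint B C → Disjoint C D →
      X \ B = A ∧ (X ∩ B).card = 2 ∧ Y \ B ⊆ C := by
    intro A hA B hB C hC D hD hAB hBC hCD
    refine path_end_rigid hX hA hB hAB hBC fun A' hA' B' hB' hAB' hBC' => ?_
    obtain ⟨-, h₁, h₂⟩ := H A hA B hB C hC D hD hAB hBC hCD
    obtain ⟨-, h₃, h₄⟩ := H A' hA' B' hB' C hC D hD hAB' hBC' hCD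
    rw [← Finset.sdiff_sdiff_eq_self h₁, ← Finset.sdiff_sdiff_eq_self h₃, ← h₂, ← h₄]
  obtain ⟨hA_eq, hXB, hYC⟩ := rigid₁ A hA B hB C hC D hD hAB hBC hCD
  obtain ⟨-, hWC, hZB⟩ : W \ C = D ∧ (W ∩ C).card = 2 ∧ Z \ C ⊆ B := by
    refine path_end_rigid hW hD hC hCD.symm hBC.symm fun D' hD' C' hC' hDC' hCB' => ?_
    obtain ⟨h₀, -, h₂⟩ := H A hA B hB C hC D hD hAB hBC hCD
    obtain ⟨h₃, -, h₄⟩ := H A hA B hB C' hC' D' hD' hAB hCB'.symm hDC'.symm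
    rw [← Finset.sdiff_sdiff_eq_self h₀, ← Finset.sdiff_sdiff_eq_self h₃, h₂, h₄]
  have hB' := mem_powersetCard.1 hB
  have hC' := mem_powersetCard.1 hC
  obtain ⟨u, hu, huX⟩ : ∃ u ∈ B, u ∉ X := by
    by_contra! hcon
    rw [inter_eq_right.2 hcon] at hXB
    omega
  obtain ⟨y, hy, hyW⟩ : ∃ y ∈ C, y ∉ W := by
    by_contra! hcon
    rw [inter_eq_right.2 hcon] at hWC
    omega
  have hWC_eq := inter_eq_erase hC'.2 hWC hy hyW
  obtain ⟨s, hs, hsu⟩ : ∃ s ∈ Z \ C, s ≠ u :=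
    exists_mem_ne (by have := le_card_sdiff C Z; omega) u
  obtain ⟨p, hp, hpy⟩ : ∃ p ∈ Y \ B, p ≠ y :=
    exists_mem_ne (by have := le_card_sdiff B Y; omega) y
  have hsB := hZB hs
  have hpC := hYC hp
  rw [mem_sdiff] at hs hp
  have hpW : p ∈ W := (mem_inter.1 (hWC_eq ▸ mem_erase.2 ⟨hpy, hpC⟩ : p ∈ W ∩ C)).1
  have hps : p ≠ s := fun e => hp.2 (e ▸ hsB)
  have hB₁ := mem_swap_powersetCard hB hsB hp.1 hp.2
  have hC₁ := mem_swap_powersetCard hC hpC hs.1 hs.2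
  have hu₁ : u ∈ insert p (B.erase s) := mem_insert_of_mem (mem_erase.2 ⟨hsu.symm, hu⟩)
  have hy₁ : y ∈ insert s (C.erase p) := mem_insert_of_mem (mem_erase.2 ⟨hpy.symm, hy⟩)
  have hBC₁ : Disjoint (insert p (B.erase s)) (insert s (C.erase p)) := by
    rw [disjoint_left] at hBC ⊢
    grind
  obtain ⟨A₁, hA₁, -⟩ := exists_triple_superset (empty_subset (X \ insert p (B.erase s)))
    (by simp) (three_le_card_sdiff hX.ge (mem_powersetCard.1 hB₁).2 hu₁ huX)
  obtain ⟨D₁, hD₁, hpD₁⟩ := exists_triple_superset (D := {p}) (L := W \ insert s (C.erase p))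
    (by grind) (by simp)
    (three_le_card_sdiff hW.ge (mem_powersetCard.1 hC₁).2 hy₁ hyW)
  rw [mem_powersetCard, subset_sdiff] at hA₁ hD₁
  have hA₂ := mem_powersetCard.2 ⟨hA₁.1.1, hA₁.2⟩
  have hD₂ := mem_powersetCard.2 ⟨hD₁.1.1, hD₁.2⟩
  obtain ⟨-, hXB₁, -⟩ := rigid₁ A₁ hA₂ _ hB₁ _ hC₁ D₁ hD₂ hA₁.1.2 hBC₁ hD₁.1.2.symm
  have hXB₁_eq := inter_eq_erase (mem_powersetCard.1 hB₁).2 hXB₁ hu₁ huX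
  have hpX : p ∈ X := by
    have : p ∈ X ∩ insert p (B.erase s) := by
      rw [hXB₁_eq]
      exact mem_erase.2 ⟨fun e => hp.2 (e ▸ hu), mem_insert_self _ _⟩
    exact (mem_inter.1 this).1
  have hpA : p ∈ A := hA_eq ▸ mem_sdiff.2 ⟨hpX, hp.2⟩
  have hpP : p ∈ P :=
    (H A₁ hA₂ _ hB₁ _ hC₁ D₁ hD₂ hA₁.1.2 hBC₁ hD₁.1.2.symm).1 (hpD₁ (by simp))
  have hpQ : p ∈ Q \ A := (H A hA B hB C hC D hD hAB hBC hCD).2.2 ▸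
    mem_sdiff.2 ⟨hpP, disjoint_left.1 hCD hpC⟩
  exact (mem_sdiff.1 hpQ).2 hpA

/-- When a two-element part `D` of the middle color is fixed, at most one third element forces
the neighbor to be colored `F`. -/
lemma card_filter_forced_le_one {X Y D F : Finset ℕ} {u : ℕ} (hX : X.card = 5) (hD : D.card = 2)
    (hu : u ∈ D) (huX : u ∉ X) :
    ((Y \ D).filter fun a => X \ insert a D ⊆ F ∧ F ∈ X.powersetCard 3 ∧
      Disjoint F (insert a D)).card ≤ 1 := by
  rw [card_le_one]
  intro a ha b hb
  simp only [mem_filter, mem_sdiff, disjoint_insert_right, mem_powersetCard] at ha hb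
  by_contra hab
  have haX : a ∉ X := fun haX => ha.2.2.2.1 (hb.2.1 (by grind))
  have h₁ : X \ D.erase u ⊆ F := by
    intro x hx
    exact ha.2.1 (by grind)
  have h₂ := le_card_sdiff (D.erase u) X
  have h₃ := card_le_card h₁
  rw [card_erase_of_mem hu] at h₂
  have := ha.2.2.1.2
  omega

/-- A colorable path on three vertices has a coloring in which each end avoids a prescribed
triple. -/
lemma exists_path_three {X Y Z A B C F G : Finset ℕ}
    (hX : X.card = 5) (hY : Y.card = 5) (hZ : Z.card = 5)
    (hA : A ∈ X.powersetCard 3) (hB : B ∈ Y.powersetCard 3) (hC : C ∈ Z.powersetCard 3)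
    (hAB : Disjoint A B) (hBC : Disjoint B C) :
    ∃ A ∈ X.powersetCard 3, ∃ B ∈ Y.powersetCard 3, ∃ C ∈ Z.powersetCard 3,
      Disjoint A B ∧ Disjoint B C ∧ A ≠ F ∧ C ≠ G := by
  simp only [mem_powersetCard] at hA hB hC
  have outside : ∀ {X A : Finset ℕ}, X.card = 5 → A ⊆ X → A.card = 3 → Disjoint A B →
      ∃ u ∈ B, u ∉ X := by
    intro X A hX hAX hA hAB
    by_contra! hcon
    have := card_le_card (union_subset hAX hcon)
    rw [card_union_of_disjoint hAB] at this
    omega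
  obtain ⟨u, huB, huX⟩ := outside hX hA.1 hA.2 hAB
  obtain ⟨w, hwB, hwZ⟩ := outside hZ hC.1 hC.2 hBC.symm
  obtain ⟨D, huwD, hDY, hD⟩ := exists_subsuperset_card_eq (s := {u, w}) (t := Y) (n := 2)
    (insert_subset (hB.1 huB) (singleton_subset_iff.2 (hB.1 hwB))) card_le_two (by omega)
  have hu : u ∈ D := huwD (by simp)
  have hw : w ∈ D := huwD (by simp)
  have h₁ := card_filter_forced_le_one (Y := Y) (F := F) hX hD hu huX
  have h₂ := card_filter_forced_le_one (Y := Y) (F := G) hZ hD hw hwZ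
  have h₃ := le_card_sdiff D Y
  obtain ⟨a, ha, ha'⟩ := exists_mem_notMem_of_card_lt_card
    (((card_union_le _ _).trans (Nat.add_le_add h₁ h₂)).trans_lt (by omega : 1 + 1 < (Y \ D).card))
  have haD := mem_sdiff.1 ha
  have hB₁ : (insert a D).card = 3 := by rw [card_insert_of_notMem haD.2, hD]
  rw [mem_union, not_or] at ha'
  have choice : ∀ {X F : Finset ℕ} {u : ℕ}, X.card = 5 → u ∈ D → u ∉ X →
      a ∉ (Y \ D).filter (fun a => X \ insert a D ⊆ F ∧ F ∈ X.powersetCard 3 ∧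
        Disjoint F (insert a D)) →
      ∃ A ∈ X.powersetCard 3, Disjoint A (insert a D) ∧ A ≠ F := by
    intro X F u hX hu huX ha'
    have hcard := three_le_card_sdiff hX.ge hB₁ (mem_insert_of_mem hu) huX
    by_contra! H
    have triple : ∀ E ⊆ X \ insert a D, E.card ≤ 3 →
        E ⊆ F ∧ F ∈ X.powersetCard 3 ∧ Disjoint F (insert a D) := by
      intro E hE hE₃
      obtain ⟨A, hA, hEA⟩ := exists_triple_superset hE hE₃ hcard
      rw [mem_powersetCard, subset_sdiff] at hA
      have hA' := mem_powersetCard.2 ⟨hA.1.1, hA.2⟩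
      have := H A hA' hA.1.2
      subst this
      exact ⟨hEA, hA', hA.1.2⟩
    refine ha' (mem_filter.2 ⟨ha, fun x hx => ?_, (triple ∅ (by simp) (by simp)).2⟩)
    exact (triple {x} (by simpa using hx) (by simp)).1 (by simp)
  obtain ⟨A₁, hA₁, hAB₁, hAF⟩ := choice hX hu huX ha'.1
  obtain ⟨C₁, hC₁, hCB₁, hCG⟩ := choice hZ hw hwZ ha'.2
  exact ⟨A₁, hA₁, _, mem_powersetCard.2 ⟨insert_subset haD.1 hDY, hB₁⟩, C₁, hC₁, hAB₁,
    hCB₁.symm, hAF, hCG⟩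

lemma exists_mem_forall_not_blocked {L M A : Finset ℕ} (hL : L.card = 8) (hM : 5 ≤ M.card)
    (hA : A.card = 3) (h : A ≠ L \ M) : ∃ x ∈ M, ∀ B, x ∈ B → ¬ Blocked L A B := by
  by_contra! H
  obtain ⟨m, hm⟩ := card_pos.1 (by omega : 0 < M.card)
  obtain ⟨-, -, hAL, -⟩ := H m hm
  have hML : M ⊆ L := fun x hx => by
    obtain ⟨B, hxB, -, hBL, -⟩ := H x hx
    exact hBL hxB
  have hAM : Disjoint A M := disjoint_right.2 fun x hx => by
    obtain ⟨B, hxB, -, -, hAB⟩ := H x hx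
    exact disjoint_right.1 hAB hxB
  refine h (eq_of_subset_of_card_le (subset_sdiff.2 ⟨hAL, hAM⟩) ?_)
  rw [card_sdiff_of_subset hML]
  omega

/-- `PairsExtend P Q X Y Z W`: the edges with lists `X`, `Y` and `Z`, `W` have colorings that
block neither the common neighbor of `X` and `W` with list `P`, nor that of `Y` and `Z` with
list `Q`. -/
def PairsExtend (P Q X Y Z W : Finset ℕ) : Prop :=
  ∃ A ∈ X.powersetCard 3, ∃ B ∈ Y.powersetCard 3, ∃ C ∈ Z.powersetCard 3,
    ∃ D ∈ W.powersetCard 3, Disjoint A B ∧ Disjoint C D ∧ ¬ Blocked P A D ∧ ¬ Blocked Q B C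

lemma PairsExtend.reflect {P Q X Y Z W : Finset ℕ} (h : PairsExtend P Q X Y Z W) :
    PairsExtend P Q W Z Y X := by
  obtain ⟨A, hA, B, hB, C, hC, D, hD, hAB, hCD, hP, hQ⟩ := h
  exact ⟨D, hD, C, hC, B, hB, A, hA, hCD.symm, hAB.symm, fun h => hP h.symm, fun h => hQ h.symm⟩

lemma PairsExtend.flip {P Q X Y Z W : Finset ℕ} (h : PairsExtend P Q X Y Z W) :
    PairsExtend Q P Y X W Z := by
  obtain ⟨A, hA, B, hB, C, hC, D, hD, hAB, hCD, hP, hQ⟩ := h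
  exact ⟨B, hB, A, hA, D, hD, C, hC, hAB.symm, hCD.symm, hQ, hP⟩

lemma exists_disjoint_triples_of_ne {X Y : Finset ℕ} {m n : ℕ} (hX : X.card = 5)
    (hY : Y.card = 5) (hXY : X ≠ Y) (hm : m ∈ X) (hn : n ∈ Y) (hmn : m ≠ n) :
    ∃ A ∈ X.powersetCard 3, ∃ B ∈ Y.powersetCard 3, Disjoint A B ∧ m ∈ A ∧ n ∈ B := by
  obtain ⟨c, hc, hcY⟩ := not_subset.1 fun h => hXY (eq_of_subset_of_card_le h (by omega))
  exact exists_disjoint_triples_through hX.ge hY.ge hc hcY hm hn hmn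

lemma pairsExtend_of_mem_of_notMem {P Q X Y Z W : Finset ℕ} {c : ℕ} (hQ : Q.card = 8)
    (hX : X.card = 5) (hY : Y.card = 5) (hZ : Z.card = 5) (hW : W.card = 5)
    (hXY : X ≠ Y) (hZW : Z ≠ W) (hc : c ∈ X) (hcP : c ∉ P) : PairsExtend P Q X Y Z W := by
  obtain ⟨n, hn, k, hk, hnk⟩ : ∃ n ∈ Y.erase c, ∃ k ∈ Z, n ∉ Q ∨ k ∉ Q ∨ n = k := by
    by_contra! H
    have hYc : 4 ≤ (Y.erase c).card := by
      have := pred_card_le_card_erase (s := Y) (a := c)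
      omega
    obtain ⟨n₀, hn₀⟩ := card_pos.1 (by omega : 0 < (Y.erase c).card)
    obtain ⟨k₀, hk₀⟩ := card_pos.1 (by omega : 0 < Z.card)
    have hsub : Y.erase c ∪ Z ⊆ Q :=
      union_subset (fun n hn => (H n hn k₀ hk₀).1) fun k hk => (H n₀ hn₀ k hk).2.1
    have hdisj : Disjoint (Y.erase c) Z := disjoint_left.2 fun n hn hn' => (H n hn n hn').2.2 rfl
    have := card_le_card hsub
    rw [card_union_of_disjoint hdisj] at this
    omega
  rw [mem_erase] at hn
  obtain ⟨A, hA, B, hB, hAB, hcA, hnB⟩ :=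
    exists_disjoint_triples_of_ne hX hY hXY hc hn.2 hn.1.symm
  obtain ⟨l, hl, hlk⟩ := exists_mem_ne (by omega : 1 < W.card) k
  obtain ⟨C, hC, D, hD, hCD, hkC, -⟩ :=
    exists_disjoint_triples_of_ne hZ hW hZW hk hl hlk.symm
  refine ⟨A, hA, B, hB, C, hC, D, hD, hAB, hCD, fun h => hcP (h.1 hcA), fun h => ?_⟩
  rcases hnk with h' | h' | rfl
  · exact h' (h.1 hnB)
  · exact h' (h.2.1 hkC)
  · exact disjoint_left.1 h.2.2 hnB hkC

lemma pairsExtend_of_ne {P Q X Y Z W : Finset ℕ} (hP : P.card = 8) (hQ : Q.card = 8)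
    (hX : X.card = 5) (hY : Y.card = 5) (hZ : Z.card = 5) (hW : W.card = 5)
    (hXY : X ≠ Y) (hZW : Z ≠ W) : PairsExtend P Q X Y Z W := by
  by_cases hXP : X ⊆ P; swap
  · obtain ⟨c, hc, hc'⟩ := not_subset.1 hXP
    exact pairsExtend_of_mem_of_notMem hQ hX hY hZ hW hXY hZW hc hc'
  by_cases hYQ : Y ⊆ Q; swap
  · obtain ⟨c, hc, hc'⟩ := not_subset.1 hYQ
    exact (pairsExtend_of_mem_of_notMem hP hY hX hW hZ hXY.symm hZW.symm hc hc').flip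
  by_cases hZQ : Z ⊆ Q; swap
  · obtain ⟨c, hc, hc'⟩ := not_subset.1 hZQ
    exact (pairsExtend_of_mem_of_notMem hP hZ hW hX hY hZW hXY hc hc').reflect.flip
  by_cases hWP : W ⊆ P; swap
  · obtain ⟨c, hc, hc'⟩ := not_subset.1 hWP
    exact (pairsExtend_of_mem_of_notMem hQ hW hZ hY hX hZW.symm hXY.symm hc hc').reflect
  have h₁ := card_union_add_card_inter X W
  have h₂ := card_union_add_card_inter Y Z
  have h₃ := card_le_card (union_subset hXP hWP)
  have h₄ := card_le_card (union_subset hYQ hZQ)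
  obtain ⟨m, hm⟩ := card_pos.1 (by omega : 0 < (X ∩ W).card)
  obtain ⟨n, hn, hnm⟩ := exists_mem_ne (by omega : 1 < (Y ∩ Z).card) m
  rw [mem_inter] at hm hn
  obtain ⟨A, hA, B, hB, hAB, hmA, hnB⟩ :=
    exists_disjoint_triples_of_ne hX hY hXY hm.1 hn.1 hnm.symm
  obtain ⟨C, hC, D, hD, hCD, hnC, hmD⟩ :=
    exists_disjoint_triples_of_ne hZ hW hZW hn.2 hm.2 hnm
  exact ⟨A, hA, B, hB, C, hC, D, hD, hAB, hCD, fun h => disjoint_left.1 h.2.2 hmA hmD,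
    fun h => disjoint_left.1 h.2.2 hnB hnC⟩

lemma exists_isL3Coloring_of_triples {L : Fin 6 → Finset ℕ} (i : Fin 6)
    (h : ∃ A₀ ∈ (L i).powersetCard 3, ∃ A₁ ∈ (L (i + 1)).powersetCard 3,
      ∃ A₂ ∈ (L (i + 2)).powersetCard 3, ∃ A₃ ∈ (L (i + 3)).powersetCard 3,
      ∃ A₄ ∈ (L (i + 4)).powersetCard 3, ∃ A₅ ∈ (L (i + 5)).powersetCard 3,
      Disjoint A₀ A₁ ∧ Disjoint A₁ A₂ ∧ Disjoint A₂ A₃ ∧ Disjoint A₃ A₄ ∧ Disjoint A₄ A₅ ∧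
        Disjoint A₅ A₀) :
    ∃ φ, IsL3Coloring (SimpleGraph.cycleGraph 6) L φ := by
  obtain ⟨A₀, h₀, A₁, h₁, A₂, h₂, A₃, h₃, A₄, h₄, A₅, h₅, d₀, d₁, d₂, d₃, d₄, d₅⟩ := h
  let ψ : Fin 6 → Finset ℕ := ![A₀, A₁, A₂, A₃, A₄, A₅]
  have hψ : ∀ k, ψ k ∈ (L (i + k)).powersetCard 3 := by
    intro k
    fin_cases k
    · simpa [ψ] using h₀
    all_goals assumption
  have hψd : ∀ k, Disjoint (ψ k) (ψ (k + 1)) := by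
    intro k
    fin_cases k <;> assumption
  have hψL : ∀ v, ψ (v - i) ∈ (L v).powersetCard 3 := fun v => by
    simpa using hψ (v - i)
  refine ⟨fun v => ψ (v - i), fun v => (mem_powersetCard.1 (hψL v)).1,
    fun v => (mem_powersetCard.1 (hψL v)).2, fun u v huv => ?_⟩
  beta_reduce
  rw [SimpleGraph.cycleGraph_adj] at huv
  rcases huv with huv | huv
  · have : u - i = v - i + 1 := by rw [← huv]; abel
    rw [this]
    exact (hψd _).symm
  · have : v - i = u - i + 1 := by rw [← huv]; abel
    rw [this]
    exact hψd _

lemma exists_eq_pair_of_card_eq_two (S : Finset (Fin 6)) (hS : S.card = 2) :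
    ∃ i : Fin 6, S = {i, i + 1} ∨ S = {i, i + 2} ∨ S = {i, i + 3} := by
  revert S
  decide

theorem stmt_9 (L : Fin 6 → Finset ℕ)
    (hL : ∀ v : Fin 6, 5 ≤ (L v).card)
    (S : Finset (Fin 6)) (hS : S.card = 2)
    (hS8 : ∀ u ∈ S, (L u).card = 8)
    (hsub : HasL3ColoringOn (SimpleGraph.cycleGraph 6) L {v : Fin 6 | v ∉ S}) :
    ∃ φ, IsL3Coloring (SimpleGraph.cycleGraph 6) L φ := by
  obtain ⟨φ, hφL, hφ3, hφd⟩ := hsub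
  have trim : ∀ v ∉ S, ∃ M ⊆ L v, M.card = 5 ∧ φ v ∈ M.powersetCard 3 := by
    intro v hv
    obtain ⟨M, h₁, h₂, h₃⟩ := exists_subsuperset_card_eq (n := 5) (hφL v hv)
      (by rw [hφ3 v hv]; norm_num) (hL v)
    exact ⟨M, h₂, h₃, mem_powersetCard.2 ⟨h₁, hφ3 v hv⟩⟩
  have disj : ∀ u v, u ∉ S → v ∉ S → v - u = 1 → Disjoint (φ u) (φ v) := fun u v hu hv huv =>
    hφd u hu v hv (SimpleGraph.cycleGraph_adj.2 (.inr huv))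
  have card3 : ∀ {M A : Finset ℕ}, A ∈ M.powersetCard 3 → A.card = 3 := fun h =>
    (mem_powersetCard.1 h).2
  have lists_ne : ∀ {X Y A B : Finset ℕ}, X.card = 5 → A ∈ X.powersetCard 3 →
      B ∈ Y.powersetCard 3 → Disjoint A B → X ≠ Y := by
    rintro X _ A B hX hA hB hAB rfl
    rw [mem_powersetCard] at hA hB
    have := card_le_card (union_subset hA.1 hB.1)
    rw [card_union_of_disjoint hAB] at this
    omega
  obtain ⟨i, rfl | rfl | rfl⟩ := exists_eq_pair_of_card_eq_two S hS
  · obtain ⟨n₂, n₃, n₄, n₅⟩ : i + 2 ∉ ({i, i + 1} : Finset (Fin 6)) ∧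
        i + 3 ∉ ({i, i + 1} : Finset (Fin 6)) ∧ i + 4 ∉ ({i, i + 1} : Finset (Fin 6)) ∧
        i + 5 ∉ ({i, i + 1} : Finset (Fin 6)) := by
      clear * -
      revert i
      decide
    obtain ⟨X, hXL, hX, hA⟩ := trim _ n₂
    obtain ⟨Y, hYL, hY, hB⟩ := trim _ n₃
    obtain ⟨Z, hZL, hZ, hC⟩ := trim _ n₄
    obtain ⟨W, hWL, hW, hD⟩ := trim _ n₅
    have hP := hS8 i (by simp)
    have hQ := hS8 (i + 1) (by simp)
    obtain ⟨A, hA, B, hB, C, hC, D, hD, hAB, hBC, hCD, hbad⟩ :=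
      exists_path_four (P := L i) (Q := L (i + 1)) hX hY hZ hW hA hB hC hD
        (disj _ _ n₂ n₃ (by rw [add_sub_add_left_eq_sub]; rfl))
        (disj _ _ n₃ n₄ (by rw [add_sub_add_left_eq_sub]; rfl))
        (disj _ _ n₄ n₅ (by rw [add_sub_add_left_eq_sub]; rfl))
    obtain ⟨E, hE, F, hF, hED, hFA, hEF⟩ :=
      exists_triples_of_adjacent hP hQ (card3 hD) (card3 hA) hbad
    exact exists_isL3Coloring_of_triples i ⟨E, hE, F, hF, A, powersetCard_mono hXL hA,
      B, powersetCard_mono hYL hB, C, powersetCard_mono hZL hC, D, powersetCard_mono hWL hD,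
      hEF, hFA, hAB, hBC, hCD, hED.symm⟩
  · obtain ⟨n₃, n₄, n₅⟩ : i + 3 ∉ ({i, i + 2} : Finset (Fin 6)) ∧
        i + 4 ∉ ({i, i + 2} : Finset (Fin 6)) ∧ i + 5 ∉ ({i, i + 2} : Finset (Fin 6)) := by
      clear * -
      revert i
      decide
    obtain ⟨X, hXL, hX, hA⟩ := trim _ n₃
    obtain ⟨Y, hYL, hY, hB⟩ := trim _ n₄
    obtain ⟨Z, hZL, hZ, hC⟩ := trim _ n₅
    have hP := hS8 i (by simp)
    have hQ := hS8 (i + 2) (by simp)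
    have hM := hL (i + 1)
    obtain ⟨A, hA, B, hB, C, hC, hAB, hBC, hAF, hCG⟩ :=
      exists_path_three (F := L (i + 2) \ L (i + 1)) (G := L i \ L (i + 1)) hX hY hZ hA hB hC
        (disj _ _ n₃ n₄ (by rw [add_sub_add_left_eq_sub]; rfl))
        (disj _ _ n₄ n₅ (by rw [add_sub_add_left_eq_sub]; rfl))
    obtain ⟨x, hx, hxA⟩ := exists_mem_forall_not_blocked hQ hM (card3 hA) hAF
    obtain ⟨y, hy, hyC⟩ := exists_mem_forall_not_blocked hP hM (card3 hC) hCG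
    obtain ⟨D, hD, hxyD⟩ := exists_triple_superset (D := {x, y})
      (insert_subset hx (singleton_subset_iff.2 hy)) (card_le_two.trans (by norm_num))
      (by omega)
    obtain ⟨E, hE, hEC, hED⟩ := exists_triple_of_not_blocked hP (card3 hC) (card3 hD)
      (hyC D (hxyD (by simp)))
    obtain ⟨F, hF, hFA, hFD⟩ := exists_triple_of_not_blocked hQ (card3 hA) (card3 hD)
      (hxA D (hxyD (by simp)))
    exact exists_isL3Coloring_of_triples i ⟨E, hE, D, hD, F, hF, A, powersetCard_mono hXL hA,
      B, powersetCard_mono hYL hB, C, powersetCard_mono hZL hC,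
      hED, hFD.symm, hFA, hAB, hBC, hEC.symm⟩
  · obtain ⟨n₁, n₂, n₄, n₅⟩ : i + 1 ∉ ({i, i + 3} : Finset (Fin 6)) ∧
        i + 2 ∉ ({i, i + 3} : Finset (Fin 6)) ∧ i + 4 ∉ ({i, i + 3} : Finset (Fin 6)) ∧
        i + 5 ∉ ({i, i + 3} : Finset (Fin 6)) := by
      clear * -
      revert i
      decide
    obtain ⟨X, hXL, hX, hA⟩ := trim _ n₁
    obtain ⟨Y, hYL, hY, hB⟩ := trim _ n₂
    obtain ⟨Z, hZL, hZ, hC⟩ := trim _ n₄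
    obtain ⟨W, hWL, hW, hD⟩ := trim _ n₅
    have hP := hS8 i (by simp)
    have hQ := hS8 (i + 3) (by simp)
    obtain ⟨A, hA, B, hB, C, hC, D, hD, hAB, hCD, hAD, hBC⟩ :=
      pairsExtend_of_ne hP hQ hX hY hZ hW
        (lists_ne hX hA hB (disj _ _ n₁ n₂ (by rw [add_sub_add_left_eq_sub]; rfl)))
        (lists_ne hZ hC hD (disj _ _ n₄ n₅ (by rw [add_sub_add_left_eq_sub]; rfl)))
    obtain ⟨E, hE, hEA, hED⟩ := exists_triple_of_not_blocked hP (card3 hA) (card3 hD) hAD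
    obtain ⟨F, hF, hFB, hFC⟩ := exists_triple_of_not_blocked hQ (card3 hB) (card3 hC) hBC
    exact exists_isL3Coloring_of_triples i ⟨E, hE, A, powersetCard_mono hXL hA,
      B, powersetCard_mono hYL hB, F, hF, C, powersetCard_mono hZL hC,
      D, powersetCard_mono hWL hD, hEA, hAB, hFB.symm, hFC, hCD, hED.symm⟩
end

section
/- Let H be the star graph consisting of a vertex v adjacent to three vertices v_1, v_2, v_3 (with no other edges), and let L be a list assignment for H such that |L(v_i)| = 5 for 1 ≤ i ≤ 3 and |L(v)| = 8. Then H is (L:3)-colorable. -/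
/-- The star with center `0` and leaves `1,2,3`: vertex `v` adjacent to `v₁,v₂,v₃`,
with no other edges. -/
def clawGraph : SimpleGraph (Fin 4) :=
  SimpleGraph.fromRel (fun u v => u = 0 ∧ v ≠ 0)

/-- A `3`-set that contains an element outside a `5`-set `A` leaves a `3`-subset of `A` free. -/
theorem exists_subset_card_three_disjoint {α : Type*} [DecidableEq α] {A S : Finset α} {c : α}
    (hA : A.card = 5) (hS : S.card = 3) (hcS : c ∈ S) (hcA : c ∉ A) :
    ∃ T ⊆ A, T.card = 3 ∧ Disjoint S T := by
  have hinter : (S ∩ A).card ≤ 2 := by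
    have hsub : S ∩ A ⊆ S.erase c := fun x hx => by
      rw [Finset.mem_inter] at hx
      exact Finset.mem_erase.2 ⟨fun h => hcA (h ▸ hx.2), hx.1⟩
    simpa [Finset.card_erase_of_mem hcS, hS] using Finset.card_le_card hsub
  have hcard : 3 ≤ (A \ S).card := by
    rw [Finset.card_sdiff]
    omega
  obtain ⟨T, hT, hT3⟩ := Finset.exists_subset_card_eq hcard
  exact ⟨T, hT.trans Finset.sdiff_subset, hT3,
    Finset.disjoint_of_subset_right hT Finset.disjoint_sdiff⟩

theorem stmt_10 (L : Fin 4 → Finset ℕ)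
    (hc : (L 0).card = 8)
    (h1 : (L 1).card = 5) (h2 : (L 2).card = 5) (h3 : (L 3).card = 5) :
    ∃ φ, IsL3Coloring clawGraph L φ := by
  have hex : ∀ A : Finset ℕ, A.card = 5 → ∃ c ∈ L 0, c ∉ A := fun A hA =>
    Finset.exists_mem_notMem_of_card_lt_card (by omega)
  obtain ⟨c₁, hc₁, hn₁⟩ := hex _ h1
  obtain ⟨c₂, hc₂, hn₂⟩ := hex _ h2
  obtain ⟨c₃, hc₃, hn₃⟩ := hex _ h3
  have hsub : ({c₁, c₂, c₃} : Finset ℕ) ⊆ L 0 := by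
    simp [Finset.insert_subset_iff, hc₁, hc₂, hc₃]
  obtain ⟨S, hcS, hSL, hS⟩ := Finset.exists_subsuperset_card_eq hsub
    (Finset.card_le_three (a := c₁) (b := c₂) (c := c₃)) (by omega)
  obtain ⟨T₁, hT₁, ht₁, hd₁⟩ :=
    exists_subset_card_three_disjoint h1 hS (hcS (by simp)) hn₁
  obtain ⟨T₂, hT₂, ht₂, hd₂⟩ :=
    exists_subset_card_three_disjoint h2 hS (hcS (by simp)) hn₂
  obtain ⟨T₃, hT₃, ht₃, hd₃⟩ :=
    exists_subset_card_three_disjoint h3 hS (hcS (by simp)) hn₃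
  refine ⟨![S, T₁, T₂, T₃], ?_, ?_, ?_⟩
  · intro v
    fin_cases v <;> assumption
  · intro v
    fin_cases v <;> assumption
  · intro u v huv
    fin_cases u <;> fin_cases v <;>
      simp_all [clawGraph, SimpleGraph.fromRel_adj, disjoint_comm]
end

section
/- Let H be a graph consisting of a vertex v adjacent to four vertices v_1, v_2, v_3, v_4, possibly together with the edge v_3v_4 (and no other edges), and let L be a list assignment for H with |L(v_1)| = |L(v_2)| = 5 and |L(v)| = 8, such that either (i) v_3v_4 is not an edge of H and |L(v_3)| = |L(v_4)| = 5, or (ii) v_3v_4 is an edge of H, |L(v_3)| = |L(v_4)| = 8, and the triangle v v_3 v_4 is (L:3)-colorable. Then H is (L:3)-colorable. -/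
/-- The graph with center `v = 0` adjacent to `v₁,v₂,v₃,v₄ = 1,2,3,4`, together with
the edge `v₃v₄` if `e = true`, and no other edges. -/
def claw5Graph (e : Bool) : SimpleGraph (Fin 5) :=
  SimpleGraph.fromRel (fun u v => (u = 0 ∧ v ≠ 0) ∨ (e = true ∧ u = 3 ∧ v = 4))

/-- If the `k`-subsets of `A` contained in some `B i` are too few to exhaust all `k`-subsets
of `A`, then some `k`-subset of `A` is contained in no `B i`. -/
theorem exists_subset_card_eq_forall_not_subset {α ι : Type*} [DecidableEq α] [Fintype ι]
    (A : Finset α) (B : ι → Finset α) (k : ℕ)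
    (h : ∑ i, (A ∩ B i).card.choose k < A.card.choose k) :
    ∃ S ⊆ A, S.card = k ∧ ∀ i, ¬ S ⊆ B i := by
  have hlt : (Finset.univ.biUnion fun i => (A ∩ B i).powersetCard k).card <
      (A.powersetCard k).card := by
    refine Finset.card_biUnion_le.trans_lt ?_
    simpa only [Finset.card_powersetCard] using h
  obtain ⟨S, hS, hSB⟩ := Finset.exists_mem_notMem_of_card_lt_card hlt
  obtain ⟨hSA, hSk⟩ := Finset.mem_powersetCard.1 hS
  refine ⟨S, hSA, hSk, fun i hi => hSB ?_⟩
  exact Finset.mem_biUnion.2 ⟨i, Finset.mem_univ i,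
    Finset.mem_powersetCard.2 ⟨Finset.subset_inter hSA hi, hSk⟩⟩

/-- Hall's condition for choosing disjoint `k`-subsets of two finite sets. -/
theorem exists_disjoint_subsets_card_eq {α : Type*} [DecidableEq α] {X Y : Finset α} {k : ℕ}
    (hX : k ≤ X.card) (hY : k ≤ Y.card) (hXY : 2 * k ≤ (X ∪ Y).card) :
    ∃ P ⊆ X, ∃ Q ⊆ Y, P.card = k ∧ Q.card = k ∧ Disjoint P Q := by
  suffices ∃ P ⊆ X, P.card = k ∧ k ≤ (Y \ P).card by
    obtain ⟨P, hP, hPk, hk⟩ := this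
    obtain ⟨Q, hQ, hQk⟩ := Finset.exists_subset_card_eq hk
    exact ⟨P, hP, Q, hQ.trans Finset.sdiff_subset, hPk, hQk,
      (Finset.disjoint_of_subset_left hQ Finset.sdiff_disjoint).symm⟩
  rcases le_total k (X \ Y).card with h | h
  · obtain ⟨P, hP, hPk⟩ := Finset.exists_subset_card_eq h
    refine ⟨P, hP.trans Finset.sdiff_subset, hPk, ?_⟩
    rwa [Finset.sdiff_eq_self_of_disjoint
      (Finset.disjoint_of_subset_left hP Finset.sdiff_disjoint).symm]
  · obtain ⟨P, hXP, hP, hPk⟩ :=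
      Finset.exists_subsuperset_card_eq (Finset.sdiff_subset (s := X) (t := Y)) h hX
    refine ⟨P, hP, hPk, ?_⟩
    have hsub : (X ∪ Y) \ P ⊆ Y \ P := by
      intro x hx
      have := @hXP x
      simp only [Finset.mem_sdiff, Finset.mem_union] at *
      tauto
    have := Finset.card_le_card hsub
    have := Finset.le_card_sdiff P (X ∪ Y)
    omega

theorem le_card_sdiff_of_not_subset {α : Type*} [DecidableEq α] {S T : Finset α}
    (h : ¬ S ⊆ T) : T.card + 1 ≤ (T \ S).card + S.card := by
  have hlt : (S ∩ T).card < S.card :=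
    Finset.card_lt_card ⟨Finset.inter_subset_left, fun hS => h (Finset.subset_inter_iff.1 hS).2⟩
  have := Finset.card_sdiff_add_card_inter T S
  rw [Finset.inter_comm] at this
  omega

/-- A coloring of the claw is given by a color set for the center and color sets for the leaves
that avoid it, which are disjoint at the ends of the extra edge. -/
theorem exists_isL3Coloring_claw5Graph {e : Bool} {L : Fin 5 → Finset ℕ} {S P Q : Finset ℕ}
    (hS : S ⊆ L 0) (hS3 : S.card = 3) (h1 : 3 ≤ (L 1 \ S).card) (h2 : 3 ≤ (L 2 \ S).card)
    (hP : P ⊆ L 3 \ S) (hP3 : P.card = 3) (hQ : Q ⊆ L 4 \ S) (hQ3 : Q.card = 3)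
    (hPQ : e = true → Disjoint P Q) :
    ∃ φ, IsL3Coloring (claw5Graph e) L φ := by
  obtain ⟨M, hM, hM3⟩ := Finset.exists_subset_card_eq h1
  obtain ⟨N, hN, hN3⟩ := Finset.exists_subset_card_eq h2
  rw [Finset.subset_sdiff] at hM hN hP hQ
  refine ⟨![S, M, N, P, Q], ?_, ?_, ?_⟩
  · intro v
    fin_cases v
    exacts [hS, hM.1, hN.1, hP.1, hQ.1]
  · intro v
    fin_cases v
    exacts [hS3, hM3, hN3, hP3, hQ3]
  · have key : ∀ u v : Fin 5, (u = 0 ∧ v ≠ 0) ∨ (e = true ∧ u = 3 ∧ v = 4) →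
        Disjoint (![S, M, N, P, Q] u) (![S, M, N, P, Q] v) := by
      rintro u v (⟨rfl, hv⟩ | ⟨he, rfl, rfl⟩)
      · fin_cases v
        exacts [absurd rfl hv, hM.2.symm, hN.2.symm, hP.2.symm, hQ.2.symm]
      · exact hPQ he
    intro u v huv
    rcases ((SimpleGraph.fromRel_adj _ u v).1 huv).2 with h | h
    exacts [key u v h, (key v u h).symm]

/-- If the triangle on `0, 3, 4` is colorable, then its lists have at least nine colors. -/
theorem nine_le_card_union_of_hasL3ColoringOn {L : Fin 5 → Finset ℕ}
    (h : HasL3ColoringOn (claw5Graph true) L {0, 3, 4}) :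
    9 ≤ (L 0 ∪ (L 3 ∪ L 4)).card := by
  obtain ⟨φ, hsub, hcard, hdisj⟩ := h
  have d03 := hdisj 0 (by simp) 3 (by simp) (by simp [claw5Graph])
  have d04 := hdisj 0 (by simp) 4 (by simp) (by simp [claw5Graph])
  have d34 := hdisj 3 (by simp) 4 (by simp) (by simp [claw5Graph])
  have hle := Finset.card_le_card (Finset.union_subset_union (hsub 0 (by simp))
    (Finset.union_subset_union (hsub 3 (by simp)) (hsub 4 (by simp))))
  rwa [Finset.card_union_of_disjoint (Finset.disjoint_union_right.2 ⟨d03, d04⟩),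
    Finset.card_union_of_disjoint d34, hcard 0 (by simp), hcard 3 (by simp),
    hcard 4 (by simp)] at hle

theorem stmt_11 (e : Bool) (L : Fin 5 → Finset ℕ)
    (hc : (L 0).card = 8) (h1 : (L 1).card = 5) (h2 : (L 2).card = 5)
    (hcase :
      (e = false ∧ (L 3).card = 5 ∧ (L 4).card = 5) ∨
      (e = true ∧ (L 3).card = 8 ∧ (L 4).card = 8 ∧
        HasL3ColoringOn (claw5Graph e) L {0, 3, 4})) :
    ∃ φ, IsL3Coloring (claw5Graph e) L φ := by
  have choose_le {T : Finset ℕ} {n : ℕ} (hT : T.card ≤ n) :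
      (L 0 ∩ T).card.choose 3 ≤ n.choose 3 :=
    Nat.choose_le_choose 3 ((Finset.card_le_card Finset.inter_subset_right).trans hT)
  have c5 : Nat.choose 5 3 = 10 := by decide
  have c7 : Nat.choose 7 3 = 35 := by decide
  have c8 : Nat.choose 8 3 = 56 := by decide
  have b1 := choose_le h1.le
  have b2 := choose_le h2.le
  rcases hcase with ⟨rfl, h3, h4⟩ | ⟨rfl, h3, h4, htri⟩
  · have b3 := choose_le h3.le
    have b4 := choose_le h4.le
    obtain ⟨S, hS, hS3, hSB⟩ :=
      exists_subset_card_eq_forall_not_subset (L 0) ![L 1, L 2, L 3, L 4] 3 (by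
        simp only [Fin.sum_univ_four, Matrix.cons_val, hc]
        omega)
    have s1 := le_card_sdiff_of_not_subset (hSB 0)
    have s2 := le_card_sdiff_of_not_subset (hSB 1)
    have s3 := le_card_sdiff_of_not_subset (hSB 2)
    have s4 := le_card_sdiff_of_not_subset (hSB 3)
    simp only [Matrix.cons_val] at s1 s2 s3 s4
    obtain ⟨P, hP, hP3⟩ := Finset.exists_subset_card_eq (s := L 3 \ S) (n := 3) (by omega)
    obtain ⟨Q, hQ, hQ3⟩ := Finset.exists_subset_card_eq (s := L 4 \ S) (n := 3) (by omega)
    exact exists_isL3Coloring_claw5Graph hS hS3 (by omega) (by omega) hP hP3 hQ hQ3 (by simp)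
  · have hU : 8 ≤ (L 3 ∪ L 4).card := h3 ▸ Finset.card_le_card Finset.subset_union_left
    obtain ⟨S, hS, hS3, hS1, hS2, hSU⟩ : ∃ S ⊆ L 0, S.card = 3 ∧ ¬ S ⊆ L 1 ∧ ¬ S ⊆ L 2 ∧
        6 ≤ ((L 3 ∪ L 4) \ S).card := by
      rcases hU.eq_or_lt with hU | hU
      · have hinter : (L 0 ∩ (L 3 ∪ L 4)).card ≤ 7 := by
          have := nine_le_card_union_of_hasL3ColoringOn htri
          have := Finset.card_union_add_card_inter (L 0) (L 3 ∪ L 4)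
          omega
        have b3 := Nat.choose_le_choose 3 hinter
        obtain ⟨S, hS, hS3, hSB⟩ :=
          exists_subset_card_eq_forall_not_subset (L 0) ![L 1, L 2, L 3 ∪ L 4] 3 (by
            simp only [Fin.sum_univ_three, Matrix.cons_val, hc]
            omega)
        have s3 := le_card_sdiff_of_not_subset (hSB 2)
        simp only [Matrix.cons_val] at s3
        exact ⟨S, hS, hS3, hSB 0, hSB 1, by omega⟩
      · obtain ⟨S, hS, hS3, hSB⟩ :=
          exists_subset_card_eq_forall_not_subset (L 0) ![L 1, L 2] 3 (by
            simp only [Fin.sum_univ_two, Matrix.cons_val, hc]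
            omega)
        have := Finset.le_card_sdiff S (L 3 ∪ L 4)
        exact ⟨S, hS, hS3, hSB 0, hSB 1, by omega⟩
    have s1 := le_card_sdiff_of_not_subset hS1
    have s2 := le_card_sdiff_of_not_subset hS2
    have s3 := Finset.le_card_sdiff S (L 3)
    have s4 := Finset.le_card_sdiff S (L 4)
    rw [Finset.union_sdiff_distrib] at hSU
    obtain ⟨P, hP, Q, hQ, hP3, hQ3, hPQ⟩ :=
      exists_disjoint_subsets_card_eq (k := 3) (by omega) (by omega) hSU
    exact exists_isL3Coloring_claw5Graph hS hS3 (by omega) (by omega) hP hP3 hQ hQ3 fun _ => hPQ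
end

section
/- Let H be a graph on the five vertices v, v_1, v_2, v_3, u_1 whose edge set consists of the edges vv_1, vv_2, vv_3, v_1u_1, and possibly one additional edge joining two of the vertices v_1, v_2, v_3. Let L be a list assignment for H such that |L(u_1)| = |L(v)| = 5 and |L(v_i)| = 2 + 3·deg_H(v_i) for 1 ≤ i ≤ 3, where deg_H denotes the degree in H. If the graph H − v_1 obtained by deleting v_1 is (L:3)-colorable, then H is (L:3)-colorable. -/
/-- The degree of `v` in `G` (the number of neighbors of `v`). -/
noncomputable def deg {V : Type*} (G : SimpleGraph V) (v : V) : ℕ :=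
  (G.neighborSet v).ncard

/-- The graph on vertices `v = 0`, `v₁ = 1`, `v₂ = 2`, `v₃ = 3`, `u₁ = 4` with edges
`vv₁`, `vv₂`, `vv₃`, `v₁u₁`, and additionally the edge `v₁v₂` if `e₁₂ = true`,
`v₁v₃` if `e₁₃ = true`, and `v₂v₃` if `e₂₃ = true`. -/
def claw53Graph (e12 e13 e23 : Bool) : SimpleGraph (Fin 5) :=
  SimpleGraph.fromRel (fun u v =>
    (u = 0 ∧ v = 1) ∨ (u = 0 ∧ v = 2) ∨ (u = 0 ∧ v = 3) ∨ (u = 1 ∧ v = 4) ∨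
    (e12 = true ∧ u = 1 ∧ v = 2) ∨ (e13 = true ∧ u = 1 ∧ v = 3) ∨
    (e23 = true ∧ u = 2 ∧ v = 3))

/-- Two lists of at least three colors with at least six colors in total contain disjoint
triples. -/
theorem exists_disjoint_triples_s12 {X Y : Finset ℕ} (hX : 3 ≤ X.card) (hY : 3 ≤ Y.card)
    (hXY : 6 ≤ (X ∪ Y).card) :
    ∃ C D : Finset ℕ, C ⊆ X ∧ D ⊆ Y ∧ C.card = 3 ∧ D.card = 3 ∧ Disjoint C D := by
  by_cases h : 3 ≤ (X \ Y).card
  · obtain ⟨C, hC, hC3⟩ := Finset.exists_subset_card_eq h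
    obtain ⟨D, hD, hD3⟩ := Finset.exists_subset_card_eq hY
    exact ⟨C, D, hC.trans Finset.sdiff_subset, hD, hC3, hD3,
      Finset.disjoint_of_subset_left hC (Finset.disjoint_of_subset_right hD
        Finset.sdiff_disjoint)⟩
  · obtain ⟨C, hC, hCX, hC3⟩ := Finset.exists_subsuperset_card_eq
      (Finset.sdiff_subset : X \ Y ⊆ X) (by omega : (X \ Y).card ≤ 3) hX
    have hYC : (X ∪ Y) \ C ⊆ Y \ C := by
      intro a ha
      have := @hC a
      grind
    have h3 : 3 ≤ (Y \ C).card := by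
      have := Finset.le_card_sdiff C (X ∪ Y)
      have := Finset.card_le_card hYC
      omega
    obtain ⟨D, hD, hD3⟩ := Finset.exists_subset_card_eq h3
    exact ⟨C, D, hCX, hD.trans Finset.sdiff_subset, hC3, hD3,
      Finset.disjoint_of_subset_right hD Finset.disjoint_sdiff⟩

/-- A triple different from `A₀` can be chosen in a set of five colors that is contained in
neither `T₁` nor `T₂` so that the triple is contained in neither of them. -/
theorem exists_triple_ne_not_subset {S T₁ T₂ : Finset ℕ} (A₀ : Finset ℕ) (hS : S.card = 5)
    (hA₀ : A₀.card = 3) (h₁ : ¬ S ⊆ T₁) (h₂ : ¬ S ⊆ T₂) :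
    ∃ A ⊆ S, A.card = 3 ∧ A ≠ A₀ ∧ ¬ A ⊆ T₁ ∧ ¬ A ⊆ T₂ := by
  obtain ⟨x, hxS, hx⟩ := Finset.not_subset.1 h₁
  obtain ⟨y, hyS, hy⟩ := Finset.not_subset.1 h₂
  have hxy : ({x, y} : Finset ℕ).card ≤ 2 := Finset.card_le_two
  obtain ⟨w, hwA, hw⟩ := Finset.exists_mem_notMem_of_card_lt_card
    (by omega : ({x, y} : Finset ℕ).card < A₀.card)
  have hsub : ({x, y} : Finset ℕ) ⊆ S.erase w := by
    intro a ha
    grind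
  obtain ⟨A, hA, hAS, hA3⟩ := Finset.exists_subsuperset_card_eq hsub
    (by omega : ({x, y} : Finset ℕ).card ≤ 3)
    (by have := Finset.pred_card_le_card_erase (s := S) (a := w); omega)
  refine ⟨A, hAS.trans (Finset.erase_subset _ _), hA3, ?_, ?_, ?_⟩
  · rintro rfl
    exact Finset.notMem_erase w S (hAS hwA)
  · exact fun h => hx (h (hA (by simp)))
  · exact fun h => hy (h (hA (by simp)))

/-- If the triple `A` is not exactly the complement of `U` in the eight-element list `X`,
then some triple in `U` leaves three colors of `X` available. -/
theorem exists_triple_three_le_card_sdiff {X U A : Finset ℕ} (hX : X.card = 8)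
    (hU : U.card = 5) (hA : A.card = 3) (hne : A ≠ X \ U) :
    ∃ B ⊆ U, B.card = 3 ∧ 3 ≤ (X \ (A ∪ B)).card := by
  have key : ∃ B ⊆ U, B.card = 3 ∧ (X ∩ (A ∪ B)).card ≤ 5 := by
    have bound : ∀ B : Finset ℕ, B.card = 3 → (A ∪ B).card ≤ 6 := fun B hB => by
      have := Finset.card_union_le A B
      omega
    have extend : ∀ a ∈ U, ∃ B ⊆ U, B.card = 3 ∧ a ∈ B := fun a ha => by
      obtain ⟨B, hB, hBU, hB3⟩ := Finset.exists_subsuperset_card_eq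
        (Finset.singleton_subset_iff.2 ha) (by simp : ({a} : Finset ℕ).card ≤ 3)
        (by omega : 3 ≤ U.card)
      exact ⟨B, hBU, hB3, hB (by simp)⟩
    have missing : ∀ B : Finset ℕ, B.card = 3 → ∀ a ∈ A ∪ B, a ∉ X →
        (X ∩ (A ∪ B)).card ≤ 5 := fun B hB a ha haX => by
      have : X ∩ (A ∪ B) ⊂ A ∪ B :=
        (Finset.ssubset_iff_of_subset Finset.inter_subset_right).2
          ⟨a, ha, fun h => haX (Finset.mem_inter.1 h).1⟩
      have := Finset.card_lt_card this
      have := bound B hB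
      omega
    by_cases hUX : U ⊆ X
    · have hcard : (X \ U).card = 3 := by
        rw [Finset.card_sdiff_of_subset hUX]
        omega
      have hnot : ¬ A ⊆ X \ U := fun h =>
        hne (Finset.eq_of_subset_of_card_le h (by omega))
      obtain ⟨a, haA, ha⟩ := Finset.not_subset.1 hnot
      by_cases haX : a ∈ X
      · have haU : a ∈ U := by grind
        obtain ⟨B, hBU, hB3, haB⟩ := extend a haU
        refine ⟨B, hBU, hB3, ?_⟩
        have h1 := Finset.card_union_add_card_inter A B
        have h2 : 0 < (A ∩ B).card := Finset.card_pos.2 ⟨a, Finset.mem_inter.2 ⟨haA, haB⟩⟩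
        have h3 := Finset.card_le_card (Finset.inter_subset_right : X ∩ (A ∪ B) ⊆ A ∪ B)
        omega
      · obtain ⟨B, hBU, hB3⟩ := Finset.exists_subset_card_eq (by omega : 3 ≤ U.card)
        exact ⟨B, hBU, hB3, missing B hB3 a (Finset.mem_union_left _ haA) haX⟩
    · obtain ⟨a, haU, haX⟩ := Finset.not_subset.1 hUX
      obtain ⟨B, hBU, hB3, haB⟩ := extend a haU
      exact ⟨B, hBU, hB3, missing B hB3 a (Finset.mem_union_right _ haB) haX⟩
  obtain ⟨B, hBU, hB3, hB⟩ := key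
  refine ⟨B, hBU, hB3, ?_⟩
  have := Finset.card_inter_add_card_sdiff X (A ∪ B)
  omega

/-- Lists of 11 and 8 colors at two adjacent vertices have disjoint triples avoiding `A`,
with the former also avoiding a suitable triple in the five-element list `U`. -/
theorem exists_triples_of_adjacent_s12 {X Y U A : Finset ℕ} (hX : X.card = 11) (hY : Y.card = 8)
    (hU : U.card = 5) (hA : A.card = 3) :
    ∃ B C D : Finset ℕ, B ⊆ U ∧ C ⊆ X \ (A ∪ B) ∧ D ⊆ Y \ A ∧
      B.card = 3 ∧ C.card = 3 ∧ D.card = 3 ∧ Disjoint C D := by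
  obtain ⟨B, hBU, hB3, hB⟩ : ∃ B ⊆ U, B.card = 3 ∧ B ≠ X \ Y := by
    obtain ⟨B, hBU, hB3, hB, -⟩ := exists_triple_ne_not_subset (S := U) (T₁ := ∅) (T₂ := ∅) A
      hU hA (by rintro h; simp_all) (by rintro h; simp_all)
    by_cases h : B = X \ Y
    · obtain ⟨B', h1, h2, h3, -⟩ := exists_triple_ne_not_subset (S := U) (T₁ := ∅) (T₂ := ∅) B
        hU hB3 (by rintro h; simp_all) (by rintro h; simp_all)
      exact ⟨B', h1, h2, h ▸ h3⟩
    · exact ⟨B, hBU, hB3, h⟩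
  have hXAB : 5 ≤ (X \ (A ∪ B)).card := by
    have := Finset.le_card_sdiff (A ∪ B) X
    have := Finset.card_union_le A B
    omega
  have hYA : 5 ≤ (Y \ A).card := by
    have := Finset.le_card_sdiff A Y
    omega
  have hunion : 6 ≤ (X \ (A ∪ B) ∪ Y \ A).card := by
    by_contra hlt
    have e1 : X \ (A ∪ B) = X \ (A ∪ B) ∪ Y \ A :=
      Finset.eq_of_subset_of_card_le Finset.subset_union_left (by omega)
    have e2 : Y \ A = X \ (A ∪ B) ∪ Y \ A :=
      Finset.eq_of_subset_of_card_le Finset.subset_union_right (by omega)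
    have e : X \ (A ∪ B) = Y \ A := e1.trans e2.symm
    have c1 := Finset.card_inter_add_card_sdiff X (A ∪ B)
    have c2 := Finset.card_inter_add_card_sdiff Y A
    have c3 := Finset.card_union_add_card_inter A B
    have c4 := Finset.card_le_card (Finset.inter_subset_right : X ∩ (A ∪ B) ⊆ A ∪ B)
    have c5 := congrArg Finset.card e1
    have c6 := congrArg Finset.card e2
    have hAY : Y ∩ A = A := Finset.eq_of_subset_of_card_le Finset.inter_subset_right (by omega)
    have hABX : X ∩ (A ∪ B) = A ∪ B :=
      Finset.eq_of_subset_of_card_le Finset.inter_subset_right (by omega)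
    have hAB : A ∩ B = ∅ := Finset.card_eq_zero.1 (by omega)
    apply hB
    ext a
    have q1 := Finset.ext_iff.1 e a
    have q2 := Finset.ext_iff.1 hAY a
    have q3 := Finset.ext_iff.1 hABX a
    have q4 := Finset.ext_iff.1 hAB a
    simp only [Finset.mem_sdiff, Finset.mem_inter, Finset.mem_union, Finset.notMem_empty] at *
    tauto
  obtain ⟨C, D, hC, hD, hC3, hD3, hCD⟩ :=
    exists_disjoint_triples_s12 (by omega) (by omega) hunion
  exact ⟨B, C, D, hBU, hC, hD, hB3, hC3, hD3, hCD⟩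

/-- Five disjoint enough triples give an `(L:3)`-coloring of `claw53Graph`. -/
theorem exists_isL3Coloring_claw53Graph {e12 e13 e23 : Bool} {L : Fin 5 → Finset ℕ}
    {A C₁ C₂ C₃ B : Finset ℕ}
    (hA : A ⊆ L 0) (hC₁ : C₁ ⊆ L 1 \ (A ∪ B)) (hC₂ : C₂ ⊆ L 2 \ A) (hC₃ : C₃ ⊆ L 3 \ A)
    (hB : B ⊆ L 4) (cA : A.card = 3) (c₁ : C₁.card = 3) (c₂ : C₂.card = 3) (c₃ : C₃.card = 3)
    (cB : B.card = 3) (h12 : e12 = true → Disjoint C₁ C₂) (h13 : e13 = true → Disjoint C₁ C₃)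
    (h23 : e23 = true → Disjoint C₂ C₃) :
    ∃ φ, IsL3Coloring (claw53Graph e12 e13 e23) L φ := by
  rw [Finset.subset_sdiff] at hC₁ hC₂ hC₃
  rw [Finset.disjoint_union_right] at hC₁
  refine ⟨![A, C₁, C₂, C₃, B], ?_, ?_, ?_⟩
  · intro v
    fin_cases v
    exacts [hA, hC₁.1, hC₂.1, hC₃.1, hB]
  · intro v
    fin_cases v
    exacts [cA, c₁, c₂, c₃, cB]
  · have rel : ∀ u v : Fin 5,
        (u = 0 ∧ v = 1) ∨ (u = 0 ∧ v = 2) ∨ (u = 0 ∧ v = 3) ∨ (u = 1 ∧ v = 4) ∨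
        (e12 = true ∧ u = 1 ∧ v = 2) ∨ (e13 = true ∧ u = 1 ∧ v = 3) ∨
        (e23 = true ∧ u = 2 ∧ v = 3) →
        Disjoint ((![A, C₁, C₂, C₃, B] : Fin 5 → Finset ℕ) u) (![A, C₁, C₂, C₃, B] v) := by
      rintro u v (⟨rfl, rfl⟩ | ⟨rfl, rfl⟩ | ⟨rfl, rfl⟩ | ⟨rfl, rfl⟩ | ⟨h, rfl, rfl⟩ |
        ⟨h, rfl, rfl⟩ | ⟨h, rfl, rfl⟩)
      exacts [hC₁.2.1.symm, hC₂.2.symm, hC₃.2.symm, hC₁.2.2, h12 h, h13 h, h23 h]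
    rintro u v ⟨-, h | h⟩
    exacts [rel u v h, (rel v u h).symm]

theorem not_subset_of_triples {S T P Q : Finset ℕ} (hP : P ⊆ S) (hQ : Q ⊆ T)
    (hPQ : Disjoint P Q) (cP : P.card = 3) (cQ : Q.card = 3) (cT : T.card = 5) :
    ¬ S ⊆ T := fun h => by
  have := Finset.card_le_card (Finset.union_subset (hP.trans h) hQ)
  rw [Finset.card_union_of_disjoint hPQ] at this
  omega

theorem exists_triple_sdiff {T A : Finset ℕ} (hT : T.card = 5) (hA : A.card = 3)
    (h : ¬ A ⊆ T) : ∃ C ⊆ T \ A, C.card = 3 := by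
  refine Finset.exists_subset_card_eq ?_
  have h1 := Finset.card_inter_add_card_sdiff T A
  have h2 : (T ∩ A).card < A.card := Finset.card_lt_card
    ((Finset.ssubset_iff_of_subset Finset.inter_subset_right).2 (by
      obtain ⟨a, haA, ha⟩ := Finset.not_subset.1 h
      exact ⟨a, haA, fun h => ha (Finset.mem_inter.1 h).1⟩))
  omega

theorem exists_triples_sdiff_of_eight {X Y A : Finset ℕ} (hX : X.card = 8) (hY : Y.card = 8)
    (hA : A.card = 3) (h : X = Y → ¬ A ⊆ X) :
    ∃ C D : Finset ℕ, C ⊆ X \ A ∧ D ⊆ Y \ A ∧ C.card = 3 ∧ D.card = 3 ∧ Disjoint C D := by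
  have hXA := Finset.le_card_sdiff A X
  have hYA := Finset.le_card_sdiff A Y
  refine exists_disjoint_triples_s12 (by omega) (by omega) ?_
  by_contra hlt
  rw [← Finset.union_sdiff_distrib] at hlt
  have c1 := Finset.card_inter_add_card_sdiff (X ∪ Y) A
  have c2 := Finset.card_le_card (Finset.inter_subset_right : (X ∪ Y) ∩ A ⊆ A)
  have c3 := Finset.card_le_card (Finset.subset_union_left : X ⊆ X ∪ Y)
  have e1 : X = X ∪ Y := Finset.eq_of_subset_of_card_le Finset.subset_union_left (by omega)
  have e2 : Y = X ∪ Y := Finset.eq_of_subset_of_card_le Finset.subset_union_right (by omega)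
  have e3 : (X ∪ Y) ∩ A = A :=
    Finset.eq_of_subset_of_card_le Finset.inter_subset_right (by omega)
  refine h (e1.trans e2.symm) ?_
  rw [e1]
  exact Finset.inter_eq_right.1 e3

instance (e12 e13 e23 : Bool) : DecidableRel (claw53Graph e12 e13 e23).Adj :=
  inferInstanceAs (DecidableRel (SimpleGraph.fromRel _).Adj)

theorem deg_eq_card_filter {V : Type*} [Fintype V] (G : SimpleGraph V) [DecidableRel G.Adj]
    (v : V) : deg G v = (Finset.univ.filter (G.Adj v)).card := by
  rw [deg, ← Set.ncard_coe_finset]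
  congr 1
  ext w
  simp

theorem deg_claw53Graph (e12 e13 e23 : Bool) :
    deg (claw53Graph e12 e13 e23) 1 = 2 + e12.toNat + e13.toNat ∧
    deg (claw53Graph e12 e13 e23) 2 = 1 + e12.toNat + e23.toNat ∧
    deg (claw53Graph e12 e13 e23) 3 = 1 + e13.toNat + e23.toNat := by
  simp only [deg_eq_card_filter]
  revert e12 e13 e23
  decide

theorem stmt_12 (e12 e13 e23 : Bool)
    (hone : e12.toNat + e13.toNat + e23.toNat ≤ 1)
    (L : Fin 5 → Finset ℕ)
    (hu1 : (L 4).card = 5) (hv : (L 0).card = 5)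
    (h1 : (L 1).card = 2 + 3 * deg (claw53Graph e12 e13 e23) 1)
    (h2 : (L 2).card = 2 + 3 * deg (claw53Graph e12 e13 e23) 2)
    (h3 : (L 3).card = 2 + 3 * deg (claw53Graph e12 e13 e23) 3)
    (hsub : HasL3ColoringOn (claw53Graph e12 e13 e23) L {v : Fin 5 | v ≠ 1}) :
    ∃ φ, IsL3Coloring (claw53Graph e12 e13 e23) L φ := by
  obtain ⟨d1, d2, d3⟩ := deg_claw53Graph e12 e13 e23
  rw [d1] at h1
  rw [d2] at h2
  rw [d3] at h3
  obtain ⟨φ, hφL, hφ3, hφ⟩ := hsub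
  have L0 := hφL 0 (by simp)
  have L2 := hφL 2 (by simp)
  have L3 := hφL 3 (by simp)
  have c0 := hφ3 0 (by simp)
  have c2 := hφ3 2 (by simp)
  have c3 := hφ3 3 (by simp)
  have D2 := hφ 0 (by simp) 2 (by simp) (by simp [claw53Graph])
  have D3 := hφ 0 (by simp) 3 (by simp) (by simp [claw53Graph])
  have hempty : ¬ L 0 ⊆ ∅ := fun h => by simp [Finset.subset_empty.1 h] at hv
  -- A triple at `v` different from `L v₁ \ L u₁` can be prescribed to leave `T₁` and `T₂`.
  have pick : ∀ T₁ T₂ : Finset ℕ, ¬ L 0 ⊆ T₁ → ¬ L 0 ⊆ T₂ →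
      ∃ A ⊆ L 0, A.card = 3 ∧ A ≠ L 1 \ L 4 ∧ ¬ A ⊆ T₁ ∧ ¬ A ⊆ T₂ := by
    intro T₁ T₂ hT₁ hT₂
    by_cases hcard : (L 1 \ L 4).card = 3
    · exact exists_triple_ne_not_subset _ hv hcard hT₁ hT₂
    · obtain ⟨A, hA, cA, -, hA1, hA2⟩ := exists_triple_ne_not_subset (φ 0) hv c0 hT₁ hT₂
      exact ⟨A, hA, cA, fun h => hcard (h ▸ cA), hA1, hA2⟩
  cases e12 <;> cases e13 <;> cases e23 <;> simp at hone h1 h2 h3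
  · have n2 := not_subset_of_triples L0 L2 D2 c0 c2 h2
    have n3 := not_subset_of_triples L0 L3 D3 c0 c3 h3
    obtain ⟨A, hA, cA, hne, hA2, hA3⟩ := pick _ _ n2 n3
    obtain ⟨B, hB, cB, hAB⟩ := exists_triple_three_le_card_sdiff h1 hu1 cA hne
    obtain ⟨C₁, hC₁, c₁⟩ := Finset.exists_subset_card_eq hAB
    obtain ⟨C₂, hC₂, c₂⟩ := exists_triple_sdiff h2 cA hA2
    obtain ⟨C₃, hC₃, c₃⟩ := exists_triple_sdiff h3 cA hA3
    exact exists_isL3Coloring_claw53Graph hA hC₁ hC₂ hC₃ hB cA c₁ c₂ c₃ cB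
      (by simp) (by simp) (by simp)
  · have D23 := hφ 2 (by simp) 3 (by simp) (by simp [claw53Graph])
    have n23 : L 2 = L 3 → ¬ L 0 ⊆ L 2 := fun h hsub => by
      have hle := Finset.card_le_card (Finset.union_subset (Finset.union_subset
        (L0.trans hsub) L2) (h ▸ L3))
      rw [Finset.card_union_of_disjoint (Finset.disjoint_union_left.2 ⟨D3, D23⟩),
        Finset.card_union_of_disjoint D2] at hle
      omega
    obtain ⟨A, hA, cA, hne, hA23⟩ : ∃ A ⊆ L 0, A.card = 3 ∧ A ≠ L 1 \ L 4 ∧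
        (L 2 = L 3 → ¬ A ⊆ L 2) := by
      by_cases h : L 2 = L 3
      · obtain ⟨A, hA, cA, hne, hA2, -⟩ := pick _ _ (n23 h) (n23 h)
        exact ⟨A, hA, cA, hne, fun _ => hA2⟩
      · obtain ⟨A, hA, cA, hne, -⟩ := pick _ _ hempty hempty
        exact ⟨A, hA, cA, hne, fun h' => absurd h' h⟩
    obtain ⟨B, hB, cB, hAB⟩ := exists_triple_three_le_card_sdiff h1 hu1 cA hne
    obtain ⟨C₁, hC₁, c₁⟩ := Finset.exists_subset_card_eq hAB
    obtain ⟨C₂, C₃, hC₂, hC₃, c₂, c₃, hC⟩ := exists_triples_sdiff_of_eight h2 h3 cA hA23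
    exact exists_isL3Coloring_claw53Graph hA hC₁ hC₂ hC₃ hB cA c₁ c₂ c₃ cB
      (by simp) (by simp) (fun _ => hC)
  · have n2 := not_subset_of_triples L0 L2 D2 c0 c2 h2
    obtain ⟨A, hA, cA, -, hA2, -⟩ := pick _ _ n2 n2
    obtain ⟨C₂, hC₂, c₂⟩ := exists_triple_sdiff h2 cA hA2
    obtain ⟨B, C₁, C₃, hB, hC₁, hC₃, cB, c₁, c₃, hC⟩ := exists_triples_of_adjacent_s12 h1 h3 hu1 cA
    exact exists_isL3Coloring_claw53Graph hA hC₁ hC₂ hC₃ hB cA c₁ c₂ c₃ cB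
      (by simp) (fun _ => hC) (by simp)
  · have n3 := not_subset_of_triples L0 L3 D3 c0 c3 h3
    obtain ⟨A, hA, cA, -, hA3, -⟩ := pick _ _ n3 n3
    obtain ⟨C₃, hC₃, c₃⟩ := exists_triple_sdiff h3 cA hA3
    obtain ⟨B, C₁, C₂, hB, hC₁, hC₂, cB, c₁, c₂, hC⟩ := exists_triples_of_adjacent_s12 h1 h2 hu1 cA
    exact exists_isL3Coloring_claw53Graph hA hC₁ hC₂ hC₃ hB cA c₁ c₂ c₃ cB
      (fun _ => hC) (by simp) (by simp)
end

section
/- Let H be a graph on the six vertices u_1, v_1, v, v_2, u_2, v_3 whose edge set consists of the path edges u_1v_1, v_1v, vv_2, v_2u_2, the edge vv_3, and possibly the edge v_1v_3 (and no other edges). Let L be a list assignment for H such that |L(u_1)| = |L(v)| = |L(u_2)| = 5, |L(v_2)| = 8, |L(v_3)| = 2 + 3·deg_H(v_3), and |L(v_1)| = 3·deg_H(v_1) − 1, where deg_H denotes the degree in H. If the graph H − v_2 obtained by deleting v_2 is (L:3)-colorable, then H is (L:3)-colorable. -/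
/-- The graph on vertices `u₁ = 0`, `v₁ = 1`, `v = 2`, `v₂ = 3`, `u₂ = 4`, `v₃ = 5`
with the path edges `u₁v₁`, `v₁v`, `vv₂`, `v₂u₂`, the edge `vv₃`, and additionally
the edge `v₁v₃` if `e = true` (and no other edges). -/
def claw543Graph (e : Bool) : SimpleGraph (Fin 6) :=
  SimpleGraph.fromRel (fun u v =>
    (u = 0 ∧ v = 1) ∨ (u = 1 ∧ v = 2) ∨ (u = 2 ∧ v = 3) ∨ (u = 3 ∧ v = 4) ∨
    (u = 2 ∧ v = 5) ∨ (e = true ∧ u = 1 ∧ v = 5))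

open Finset in
/-- A triple `X` not contained in a `5`-set `C` leaves room for a disjoint triple in `C`. -/
theorem exists_disjoint_triple {C X : Finset ℕ} {z : ℕ} (hC : #C = 5) (hX : #X = 3)
    (hzX : z ∈ X) (hzC : z ∉ C) : ∃ U ⊆ C, #U = 3 ∧ Disjoint X U := by
  have h : #(X ∩ C) ≤ #(X.erase z) :=
    card_le_card fun a ha => by
      rw [mem_inter] at ha
      exact mem_erase.2 ⟨fun h => hzC (h ▸ ha.2), ha.1⟩
  rw [card_erase_of_mem hzX] at h
  have h' := card_sdiff (s := X) (t := C)
  obtain ⟨U, hU, hU3⟩ := exists_subset_card_eq (s := C \ X) (n := 3) (by omega)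
  exact ⟨U, hU.trans sdiff_subset, hU3, disjoint_sdiff.mono_right hU⟩

open Finset in
/-- A set of size at least `3` has a triple containing two prescribed elements. -/
theorem exists_triple_through {M : Finset ℕ} {z w : ℕ} (hM : 3 ≤ #M) (hz : z ∈ M) (hw : w ∈ M) :
    ∃ X ⊆ M, #X = 3 ∧ z ∈ X ∧ w ∈ X := by
  have hsub : {z, w} ⊆ M := by simp [insert_subset_iff, hz, hw]
  obtain ⟨X, h1, h2, h3⟩ := exists_subsuperset_card_eq hsub (card_le_two.trans (by omega)) hM
  exact ⟨X, h2, h3, h1 (by simp), h1 (by simp)⟩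

open Finset in
/-- If `z ∈ M` lies outside `C`, the path with lists `M`, `C` is colorable. -/
theorem exists_coloring_edge {C M : Finset ℕ} {z : ℕ} (hC : #C = 5) (hM : 3 ≤ #M)
    (hzM : z ∈ M) (hzC : z ∉ C) :
    ∃ X ⊆ M, #X = 3 ∧ ∃ U ⊆ C, #U = 3 ∧ Disjoint X U := by
  obtain ⟨X, h2, h3, h4, -⟩ := exists_triple_through hM hzM hzM
  exact ⟨X, h2, h3, exists_disjoint_triple hC h3 h4 hzC⟩

open Finset in
/-- A triple disjoint from another triple inside a `5`-set cannot be contained in that set. -/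
theorem exists_mem_notMem_of_disjoint_s13 {C X U : Finset ℕ} (hC : #C ≤ 5) (hX : #X = 3)
    (hUC : U ⊆ C) (hU : #U = 3) (hd : Disjoint X U) : ∃ z ∈ X, z ∉ C := by
  by_contra! h
  have := card_le_card (union_subset (show X ⊆ C from h) hUC)
  rw [card_union_of_disjoint hd] at this
  omega

open Finset in
/-- A triple `S` in a `5`-set can be modified by exchanging one element, keeping two
prescribed elements and not introducing a third one. -/
theorem exists_exchange {A S : Finset ℕ} (w w' z : ℕ) (hA : #A = 5) (hSA : S ⊆ A) (hS : #S = 3)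
    (hz : z ∉ S) :
    ∃ T ⊆ A, #T = 3 ∧ T ≠ S ∧ (w ∈ S → w ∈ T) ∧ (w' ∈ S → w' ∈ T) ∧ z ∉ T := by
  obtain ⟨x, hxS, hx⟩ := exists_mem_notMem_of_card_lt_card
    (show #({w, w'} : Finset ℕ) < #S from card_le_two.trans_lt (by omega))
  obtain ⟨y, hyA, hy⟩ := exists_mem_notMem_of_card_lt_card
    (show #(insert z S) < #A from (card_insert_le z S).trans_lt (by omega))
  simp only [mem_insert, mem_singleton, not_or] at hx hy
  have hyS : y ∉ S.erase x := fun h => hy.2 (mem_of_mem_erase h)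
  refine ⟨insert y (S.erase x), insert_subset hyA ((erase_subset _ _).trans hSA), ?_, ?_, ?_, ?_, ?_⟩
  · rw [card_insert_of_notMem hyS, card_erase_of_mem hxS, hS]
  · rintro h
    exact hy.2 (h ▸ mem_insert_self _ _)
  · exact fun h => mem_insert_of_mem (mem_erase.2 ⟨fun e => hx.1 e.symm, h⟩)
  · exact fun h => mem_insert_of_mem (mem_erase.2 ⟨fun e => hx.2 e.symm, h⟩)
  · simp only [mem_insert, mem_erase, not_or, not_and]
    exact ⟨fun e => hy.1 e.symm, fun _ => hz⟩

open Finset in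
/-- If `w ∈ T` lies outside `D`, then removing `T` costs `D` at most two colors. -/
theorem card_le_card_sdiff_add_two {D T : Finset ℕ} {w : ℕ} (hT : #T = 3) (hwT : w ∈ T)
    (hwD : w ∉ D) : #D ≤ #(D \ T) + 2 := by
  have h : #(D ∩ T) ≤ #(T.erase w) :=
    card_le_card fun a ha => by
      rw [mem_inter] at ha
      exact mem_erase.2 ⟨fun h => hwD (h ▸ ha.1), ha.2⟩
  rw [card_erase_of_mem hwT] at h
  have := card_sdiff_add_card_inter D T
  omega

open Finset in
/-- If `P` and `Q` have sizes `8` and `5`, at most one triple `R` satisfies `P \ R ⊆ Q`. -/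
theorem exists_mem_sdiff_notMem_or {P Q S T : Finset ℕ} (hP : #P = 8) (hQ : #Q = 5)
    (hS : #S = 3) (hT : #T = 3) (hne : T ≠ S) :
    (∃ z ∈ P \ S, z ∉ Q) ∨ ∃ z ∈ P \ T, z ∉ Q := by
  by_contra! h
  have key : ∀ R : Finset ℕ, #R = 3 → (∀ z ∈ P \ R, z ∈ Q) → R = P \ Q := by
    intro R hR h
    have h1 : P \ Q ⊆ R := fun a ha => by
      by_contra hc
      rw [mem_sdiff] at ha
      exact ha.2 (h a (mem_sdiff.2 ⟨ha.1, hc⟩))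
    have h2 := le_card_sdiff Q P
    exact (eq_of_subset_of_card_le h1 (by omega)).symm
  exact hne ((key T hT h.2).trans (key S hS h.1).symm)

open Finset in
/-- Colorings of the path with lists `C`, `B`, `A`, `D` of size `5` admit a second choice
on the vertex with list `A`. -/
theorem exists_recoloring_path {A B C D S X Y U : Finset ℕ} (hA : #A = 5) (hB : #B = 5)
    (hC : #C = 5) (hD : #D = 5) (hSA : S ⊆ A) (hXB : X ⊆ B) (hUC : U ⊆ C) (hYD : Y ⊆ D)
    (hS : #S = 3) (hX : #X = 3) (hU : #U = 3) (hY : #Y = 3)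
    (hXU : Disjoint X U) (hSX : Disjoint S X) (hSY : Disjoint S Y) :
    ∃ T ⊆ A, #T = 3 ∧ T ≠ S ∧ ∃ X ⊆ B, #X = 3 ∧ ∃ U ⊆ C, #U = 3 ∧ ∃ Y ⊆ D, #Y = 3 ∧
      Disjoint X U ∧ Disjoint T X ∧ Disjoint T Y := by
  obtain ⟨z, hzX, hzC⟩ := exists_mem_notMem_of_disjoint_s13 hC.le hX hUC hU hXU
  obtain ⟨w, hwS, hwB⟩ := exists_mem_notMem_of_disjoint_s13 hB.le hS hXB hX hSX
  obtain ⟨w', hwS', hwD⟩ := exists_mem_notMem_of_disjoint_s13 hD.le hS hYD hY hSY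
  obtain ⟨T, hTA, hT, hne, hwT, hwT', hzT⟩ := exists_exchange w w' z hA hSA hS
    (disjoint_right.1 hSX hzX)
  have h1 := card_le_card_sdiff_add_two hT (hwT hwS) hwB
  have h2 := card_le_card_sdiff_add_two hT (hwT' hwS') hwD
  obtain ⟨X', hX', hX3, U', hU', hU3, hd⟩ := exists_coloring_edge (M := B \ T) hC (by omega)
    (mem_sdiff.2 ⟨hXB hzX, hzT⟩) hzC
  obtain ⟨Y', hY', hY3⟩ := exists_subset_card_eq (s := D \ T) (n := 3) (by omega)
  exact ⟨T, hTA, hT, hne, X', hX'.trans sdiff_subset, hX3, U', hU', hU3, Y',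
    hY'.trans sdiff_subset, hY3, hd, disjoint_sdiff.mono_right hX', disjoint_sdiff.mono_right hY'⟩

open Finset in
/-- Colorings of the triangle with lists `A`, `B`, `D` of sizes `5`, `8`, `8` and a pendant
vertex with list `C` of size `5` at `B` admit a second choice on the vertex with list `A`. -/
theorem exists_recoloring_triangle {A B C D S X Y U : Finset ℕ} (hA : #A = 5) (hB : #B = 8)
    (hC : #C = 5) (hD : #D = 8) (hSA : S ⊆ A) (hXB : X ⊆ B) (hUC : U ⊆ C) (hYD : Y ⊆ D)
    (hS : #S = 3) (hX : #X = 3) (hU : #U = 3) (hY : #Y = 3)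
    (hXU : Disjoint X U) (hSX : Disjoint S X) (hSY : Disjoint S Y) (hXY : Disjoint X Y) :
    ∃ T ⊆ A, #T = 3 ∧ T ≠ S ∧ ∃ X ⊆ B, #X = 3 ∧ ∃ U ⊆ C, #U = 3 ∧ ∃ Y ⊆ D, #Y = 3 ∧
      Disjoint X U ∧ Disjoint T X ∧ Disjoint T Y ∧ Disjoint X Y := by
  obtain ⟨z, hzX, hzC⟩ := exists_mem_notMem_of_disjoint_s13 hC.le hX hUC hU hXU
  obtain ⟨w, hw⟩ : ∃ w, B = D → w ∈ S ∧ w ∉ D := by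
    by_cases hBD : B = D
    · subst hBD
      by_contra! h
      have hSB : S ⊆ B := fun a ha => (h a).2 ha
      have h1 := card_le_card (union_subset (union_subset hSB hXB) hYD)
      rw [card_union_of_disjoint (disjoint_union_left.2 ⟨hSY, hXY⟩),
        card_union_of_disjoint hSX] at h1
      omega
    · exact ⟨0, fun h => absurd h hBD⟩
  obtain ⟨T, hTA, hT, hne, hwT, -, hzT⟩ := exists_exchange w w z hA hSA hS
    (disjoint_right.1 hSX hzX)
  have hBT := le_card_sdiff T B
  have hDT := le_card_sdiff T D
  have hzM : z ∈ B \ T := mem_sdiff.2 ⟨hXB hzX, hzT⟩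
  obtain ⟨X', hX', hX3, hzX', hY⟩ :
      ∃ X' ⊆ B \ T, #X' = 3 ∧ z ∈ X' ∧ 3 ≤ #((D \ T) \ X') := by
    by_cases h6 : 6 ≤ #(D \ T)
    · obtain ⟨X', h1, h2, h3, -⟩ := exists_triple_through (by omega) hzM hzM
      have := le_card_sdiff X' (D \ T)
      exact ⟨X', h1, h2, h3, by omega⟩
    · have hTD : T ⊆ D := by
        by_contra h
        obtain ⟨a, haT, haD⟩ := not_subset.1 h
        have := card_le_card_sdiff_add_two hT haT haD
        omega
      have hBD : ¬ B ⊆ D := fun h => by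
        obtain ⟨hwS, hwD⟩ := hw (eq_of_subset_of_card_le h (by omega))
        exact hwD (hTD (hwT hwS))
      obtain ⟨b, hbB, hbD⟩ := not_subset.1 hBD
      obtain ⟨X', h1, h2, h3, h4⟩ := exists_triple_through (w := b) (by omega) hzM
        (mem_sdiff.2 ⟨hbB, fun h => hbD (hTD h)⟩)
      have := card_le_card_sdiff_add_two (D := D \ T) h2 h4 fun h => hbD (mem_sdiff.1 h).1
      exact ⟨X', h1, h2, h3, by omega⟩
  obtain ⟨U', hU', hU3, hd⟩ := exists_disjoint_triple hC hX3 hzX' hzC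
  obtain ⟨Y', hY', hY3⟩ := exists_subset_card_eq hY
  exact ⟨T, hTA, hT, hne, X', hX'.trans sdiff_subset, hX3, U', hU', hU3, Y',
    (hY'.trans sdiff_subset).trans sdiff_subset, hY3, hd, disjoint_sdiff.mono_right hX',
    disjoint_sdiff.mono_right (hY'.trans sdiff_subset), disjoint_sdiff.mono_right hY'⟩

open Finset in
/-- A coloring of `claw543Graph e` minus the vertex `3` extends to the vertex `3`, possibly after
recoloring the vertex `4`, as soon as some color of the vertex `3` avoids both the vertex `2`
and the list of the vertex `4`. -/
theorem exists_isL3Coloring_of_extends {e : Bool} {L : Fin 6 → Finset ℕ} {U X T Y : Finset ℕ}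
    (hQ : #(L 4) = 5) (hP : #(L 3) = 8)
    (hUL : U ⊆ L 0) (hXL : X ⊆ L 1) (hTL : T ⊆ L 2) (hYL : Y ⊆ L 5)
    (hU : #U = 3) (hX : #X = 3) (hT : #T = 3) (hY : #Y = 3)
    (hXU : Disjoint X U) (hTX : Disjoint T X) (hTY : Disjoint T Y)
    (hXY : e = true → Disjoint X Y) (hext : ∃ z ∈ L 3 \ T, z ∉ L 4) :
    ∃ φ, IsL3Coloring (claw543Graph e) L φ := by
  obtain ⟨z, hz, hzQ⟩ := hext
  have h := le_card_sdiff T (L 3)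
  obtain ⟨Z, hZ, hZ3, W, hW, hW3, hZW⟩ := exists_coloring_edge hQ (by omega) hz hzQ
  have hTZ : Disjoint T Z := disjoint_sdiff.mono_right hZ
  have hZP : Z ⊆ L 3 := hZ.trans sdiff_subset
  refine ⟨![U, X, T, Z, W, Y], ?_, ?_, ?_⟩
  · intro v
    fin_cases v <;> simpa
  · intro v
    fin_cases v <;> simpa
  · intro u v huv
    fin_cases u <;> fin_cases v <;> simp [claw543Graph] at huv <;>
      first
        | assumption
        | exact Disjoint.symm (by assumption)
        | exact hXY huv
        | exact (hXY huv).symm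

theorem deg_claw543Graph_five (e : Bool) : deg (claw543Graph e) 5 = if e then 2 else 1 := by
  cases e
  · have : (claw543Graph false).neighborSet 5 = {2} := by
      ext v
      fin_cases v <;> simp [claw543Graph]
    simp [deg, this]
  · have : (claw543Graph true).neighborSet 5 = {1, 2} := by
      ext v
      fin_cases v <;> simp [claw543Graph]
    rw [deg, this, Set.ncard_pair (by decide)]
    rfl

theorem deg_claw543Graph_one (e : Bool) : deg (claw543Graph e) 1 = if e then 3 else 2 := by
  cases e
  · have : (claw543Graph false).neighborSet 1 = {0, 2} := by
      ext v
      fin_cases v <;> simp [claw543Graph]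
    rw [deg, this, Set.ncard_pair (by decide)]
    rfl
  · have : (claw543Graph true).neighborSet 1 = {0, 2, 5} := by
      ext v
      fin_cases v <;> simp [claw543Graph]
    rw [deg, this, Set.ncard_eq_three.2 ⟨0, 2, 5, by decide, by decide, by decide, rfl⟩]
    rfl

theorem stmt_13 (e : Bool) (L : Fin 6 → Finset ℕ)
    (hu1 : (L 0).card = 5) (hv : (L 2).card = 5) (hu2 : (L 4).card = 5)
    (hv2 : (L 3).card = 8)
    (hv3 : (L 5).card = 2 + 3 * deg (claw543Graph e) 5)
    (hv1 : (L 1).card = 3 * deg (claw543Graph e) 1 - 1)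
    (hsub : HasL3ColoringOn (claw543Graph e) L {v : Fin 6 | v ≠ 3}) :
    ∃ φ, IsL3Coloring (claw543Graph e) L φ := by
  obtain ⟨φ, hL, hcard, hadj⟩ := hsub
  have hXU : Disjoint (φ 1) (φ 0) :=
    hadj 1 (by simp) 0 (by simp) (by simp [claw543Graph])
  have hSX : Disjoint (φ 2) (φ 1) :=
    hadj 2 (by simp) 1 (by simp) (by simp [claw543Graph])
  have hSY : Disjoint (φ 2) (φ 5) :=
    hadj 2 (by simp) 5 (by simp) (by simp [claw543Graph])
  have hXY : e = true → Disjoint (φ 1) (φ 5) := fun he =>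
    hadj 1 (by simp) 5 (by simp) (by simp [claw543Graph, he])
  have hL0 : φ 0 ⊆ L 0 := hL 0 (by simp)
  have hL1 : φ 1 ⊆ L 1 := hL 1 (by simp)
  have hL2 : φ 2 ⊆ L 2 := hL 2 (by simp)
  have hL5 : φ 5 ⊆ L 5 := hL 5 (by simp)
  have hc0 : (φ 0).card = 3 := hcard 0 (by simp)
  have hc1 : (φ 1).card = 3 := hcard 1 (by simp)
  have hc2 : (φ 2).card = 3 := hcard 2 (by simp)
  have hc5 : (φ 5).card = 3 := hcard 5 (by simp)
  rw [deg_claw543Graph_five] at hv3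
  rw [deg_claw543Graph_one] at hv1
  obtain ⟨T, hTL, hT, hne, X, hXL, hX, U, hUL, hU, Y, hYL, hY, hXU', hTX, hTY, hXY'⟩ :
      ∃ T ⊆ L 2, T.card = 3 ∧ T ≠ φ 2 ∧ ∃ X ⊆ L 1, X.card = 3 ∧ ∃ U ⊆ L 0, U.card = 3 ∧
        ∃ Y ⊆ L 5, Y.card = 3 ∧ Disjoint X U ∧ Disjoint T X ∧ Disjoint T Y ∧
          (e = true → Disjoint X Y) := by
    cases e
    · simpa using exists_recoloring_path hv hv1 hu1 hv3 hL2 hL1 hL0 hL5 hc2 hc1 hc0 hc5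
        hXU hSX hSY
    · simpa using exists_recoloring_triangle hv hv1 hu1 hv3 hL2 hL1 hL0 hL5 hc2 hc1 hc0 hc5
        hXU hSX hSY (hXY rfl)
  rcases exists_mem_sdiff_notMem_or hv2 hu2 hc2 hT hne with h | h
  · exact exists_isL3Coloring_of_extends hu2 hv2 hL0 hL1 hL2 hL5 hc0 hc1 hc2 hc5
      hXU hSX hSY hXY h
  · exact exists_isL3Coloring_of_extends hu2 hv2 hUL hXL hTL hYL hU hX hT hY
      hXU' hTX hTY hXY' h
end
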